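/- arXiv:math/0512419 — 8 statements merged into one kernel-verified Lean document; each statement's English description precedes it below -/
import Mathlib

section
/- Let a, b, c be integers with gcd(a, b, c) = 1 satisfying 2b² - a² = c³. Then there exist coprime integers x, y and signs ε₁, ε₂ ∈ {1, -1} (chosen independently) such that either a = ε₁(x³ + 6xy²) and b = ε₂(3x²y + 2y³), or a = ε₁(x³ + 6x²y + 6xy² + 4y³) and b = ε₂(x³ + 3x²y + 6xy² + 2y³). -/
namespace Zsqrtd

theorem exists_natAbs_norm_sub_mul_lt (x : ℤ√2) {y : ℤ√2} (hy : y ≠ 0) :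
    ∃ q : ℤ√2, (x - y * q).norm.natAbs < y.norm.natAbs := by
  have h_norm : y.norm ≠ 0 := by
    rw [Ne, norm_eq_zero]
    · exact hy
    · intro n hn
      have h_sq : IsSquare (2 : ℤ) := ⟨n, hn⟩
      exact Int.prime_two.not_isSquare h_sq
  have near : ∀ A n : ℤ, n ≠ 0 → ∃ q : ℤ, (2 * (A - n * q)) ^ 2 ≤ n ^ 2 := by
    intro A n hn
    refine ⟨round ((A : ℚ) / n), ?_⟩
    have hn' : (n : ℚ) ≠ 0 := by exact_mod_cast hn
    have h := abs_le.mp (abs_sub_round ((A : ℚ) / n))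
    have key : (2 * ((A : ℚ) - n * round ((A : ℚ) / n))) ^ 2 ≤ (n : ℚ) ^ 2 := by
      have e : (A : ℚ) - n * round ((A : ℚ) / n) = n * ((A : ℚ) / n - round ((A : ℚ) / n)) := by
        field_simp
      rw [e]
      generalize (A : ℚ) / n - round ((A : ℚ) / n) = t at h
      have ht : 4 * t ^ 2 ≤ 1 := by nlinarith
      nlinarith [mul_nonneg (sq_nonneg (n : ℚ)) (sub_nonneg.mpr ht)]
    exact_mod_cast key
  obtain ⟨q₁, h₁⟩ := near (x * star y).re _ h_norm
  obtain ⟨q₂, h₂⟩ := near (x * star y).im _ h_norm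
  refine ⟨⟨q₁, q₂⟩, ?_⟩
  have e : (x - y * ⟨q₁, q₂⟩).norm * y.norm =
      ((x * star y).re - y.norm * q₁) ^ 2 - 2 * ((x * star y).im - y.norm * q₂) ^ 2 := by
    simp only [norm_def, re_sub, im_sub, re_mul, im_mul, re_star, im_star]
    ring
  generalize (x * star y).re - y.norm * q₁ = u at *
  generalize (x * star y).im - y.norm * q₂ = v at *
  have h_sq : 0 < y.norm ^ 2 := by positivity
  have h_abs : |(x - y * ⟨q₁, q₂⟩).norm * y.norm| < y.norm ^ 2 := by
    rw [e, abs_lt]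
    constructor <;> nlinarith [sq_nonneg u, sq_nonneg v]
  rw [abs_mul, ← sq_abs y.norm, sq] at h_abs
  have h_lt := lt_of_mul_lt_mul_right h_abs (abs_nonneg _)
  zify
  exact h_lt

theorem natAbs_norm_le_natAbs_norm_mul (x : ℤ√2) {y : ℤ√2} (hy : y ≠ 0) :
    x.norm.natAbs ≤ (x * y).norm.natAbs := by
  rw [norm_mul, Int.natAbs_mul]
  refine Nat.le_mul_of_pos_right _ (Int.natAbs_pos.mpr ?_)
  rw [Ne, norm_eq_zero]
  · exact hy
  · intro n hn
    exact Int.prime_two.not_isSquare ⟨n, hn⟩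

open Classical in
/-- The ring `ℤ[√2]` is norm-Euclidean. -/
noncomputable abbrev euclideanDomainSqrtTwo : EuclideanDomain (ℤ√2) :=
  { Zsqrtd.commRing, Zsqrtd.nontrivial with
    quotient := fun x y =>
      if hy : y ≠ 0 then (exists_natAbs_norm_sub_mul_lt x hy).choose else 0
    quotient_zero := by simp
    remainder := fun x y =>
      x - y * if hy : y ≠ 0 then (exists_natAbs_norm_sub_mul_lt x hy).choose else 0
    quotient_mul_add_remainder_eq := fun _ _ => by ring
    r := _
    r_wellFounded := (measure (Int.natAbs ∘ norm)).wf
    remainder_lt := fun x y hy => by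
      have h := (exists_natAbs_norm_sub_mul_lt x hy).choose_spec
      simp only [dif_pos hy]
      exact h
    mul_left_not_lt := fun x _ hy => not_lt_of_ge (natAbs_norm_le_natAbs_norm_mul x hy) }

instance isDomain_sqrtTwo : IsDomain (ℤ√2) :=
  letI := euclideanDomainSqrtTwo
  (inferInstance : IsDomain (ℤ√2))

instance isPrincipalIdealRing_sqrtTwo : IsPrincipalIdealRing (ℤ√2) :=
  letI := euclideanDomainSqrtTwo
  (inferInstance : IsPrincipalIdealRing (ℤ√2))

theorem isFundamental_three_two :
    Pell.IsFundamental (Pell.Solution₁.mk (d := 2) 3 2 (by norm_num)) := by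
  refine ⟨by simp, by simp, fun {b} hb => ?_⟩
  by_contra! h
  have hx : b.x = 2 := by
    simp only [Pell.Solution₁.x_mk] at h
    omega
  have hp := b.prop
  rw [hx] at hp
  omega

theorem exists_eq_pow_three_mul_pow_of_norm_eq_one {u : ℤ√2} (hu : u.norm = 1) :
    ∃ v : ℤ√2, u = v ^ 3 ∨ u = v ^ 3 * ⟨3, 2⟩ ∨ u = v ^ 3 * ⟨3, 2⟩ ^ 2 := by
  let f := Pell.Solution₁.mk (d := 2) 3 2 (by norm_num)
  let s : Pell.Solution₁ 2 := ⟨u, norm_eq_one_iff_mem_unitary.mp hu⟩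
  obtain ⟨t, r, hr, hs⟩ : ∃ t : Pell.Solution₁ 2, ∃ r : ℕ, r < 3 ∧ s = t ^ 3 * f ^ r := by
    obtain ⟨n, hn⟩ := isFundamental_three_two.eq_zpow_or_neg_zpow s
    have hf : f ^ n = (f ^ (n / 3)) ^ 3 * f ^ (n % 3).toNat := by
      rw [← zpow_natCast, ← zpow_natCast, ← zpow_mul, ← zpow_add]
      congr 1
      push_cast
      omega
    rcases hn with hn | hn
    · exact ⟨f ^ (n / 3), (n % 3).toNat, by omega, hn.trans hf⟩
    · refine ⟨-f ^ (n / 3), (n % 3).toNat, by omega, ?_⟩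
      rw [hn, Odd.neg_pow (by decide), neg_mul]
      exact congrArg Neg.neg hf
  have hu' : u = (t : ℤ√2) ^ 3 * (⟨3, 2⟩ : ℤ√2) ^ r := congrArg Subtype.val hs
  refine ⟨t, ?_⟩
  interval_cases r <;> simp_all

theorem exists_eq_pow_three_mul_of_isUnit {u : ℤ√2} (hu : IsUnit u) :
    ∃ v : ℤ√2, u = v ^ 3 ∨ u = ⟨1, 1⟩ * v ^ 3 ∨ u = ⟨1, -1⟩ * v ^ 3 := by
  have inv : (⟨1, 1⟩ * ⟨-1, 1⟩ : ℤ√2) = 1 := by decide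
  have h₃ : (⟨3, 2⟩ : ℤ√2) = ⟨1, 1⟩ ^ 2 := by decide
  have hc : (⟨1, -1⟩ : ℤ√2) = -⟨-1, 1⟩ := by decide
  rw [hc]
  rcases Int.isUnit_iff.mp ((isUnit_iff_norm_isUnit u).mp hu) with h | h
  · obtain ⟨v, hv | hv | hv⟩ := exists_eq_pow_three_mul_pow_of_norm_eq_one h
    · exact ⟨v, Or.inl hv⟩
    · refine ⟨-⟨1, 1⟩ * v, Or.inr (Or.inr ?_)⟩
      rw [hv, h₃]
      linear_combination (-v ^ 3 * ⟨1, 1⟩ ^ 2) * inv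
    · refine ⟨⟨1, 1⟩ * v, Or.inr (Or.inl ?_)⟩
      rw [hv, h₃]
      ring
  · have hn : (u * ⟨1, 1⟩).norm = 1 := by
      rw [norm_mul, h]
      decide
    obtain ⟨v, hv⟩ := exists_eq_pow_three_mul_pow_of_norm_eq_one hn
    rw [h₃] at hv
    rcases hv with hv | hv | hv
    · refine ⟨-v, Or.inr (Or.inr ?_)⟩
      linear_combination (⟨-1, 1⟩ : ℤ√2) * hv - u * inv
    · refine ⟨v, Or.inr (Or.inl ?_)⟩
      linear_combination (⟨-1, 1⟩ : ℤ√2) * hv + (v ^ 3 * ⟨1, 1⟩ - u) * inv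
    · refine ⟨⟨1, 1⟩ * v, Or.inl ?_⟩
      linear_combination (⟨-1, 1⟩ : ℤ√2) * hv + (v ^ 3 * ⟨1, 1⟩ ^ 3 - u) * inv

theorem isCoprime_mk_mk_neg {a b : ℤ} (hab : IsCoprime a b) (hodd : Odd (2 * b ^ 2 - a ^ 2)) :
    IsCoprime (⟨a, b⟩ : ℤ√2) ⟨a, -b⟩ := by
  obtain ⟨p, q, hpq⟩ := hab
  obtain ⟨m, n, hmn⟩ : IsCoprime (2 * b ^ 2 - a ^ 2) ((2 : ℤ) ^ 2) := by
    obtain ⟨k, hk⟩ := hodd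
    exact IsCoprime.pow_right ⟨1, -k, by rw [hk]; ring⟩
  refine ⟨⟨2 * n * p - m * a, n * q + m * b⟩, ⟨2 * n * p, -n * q⟩, ?_⟩
  ext
  · simp only [re_add, re_mul, re_one]
    linear_combination hmn + 4 * n * hpq
  · simp only [im_add, im_mul, im_one]
    ring

end Zsqrtd

theorem isCoprime_of_two_mul_sq_sub_sq_eq_pow_three {a b c : ℤ}
    (hgcd : Int.gcd (Int.gcd a b) c = 1) (heq : 2 * b ^ 2 - a ^ 2 = c ^ 3) :
    IsCoprime a b := by
  rw [Int.isCoprime_iff_gcd_eq_one]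
  by_contra h
  obtain ⟨p, hp, hpab⟩ := Nat.exists_prime_and_dvd h
  have hp' := Nat.prime_iff_prime_int.mp hp
  have hpa : (p : ℤ) ∣ a := (Int.natCast_dvd_natCast.mpr hpab).trans (Int.gcd_dvd_left _ _)
  have hpb : (p : ℤ) ∣ b := (Int.natCast_dvd_natCast.mpr hpab).trans (Int.gcd_dvd_right _ _)
  have hpc : (p : ℤ) ∣ c := by
    refine hp'.dvd_of_dvd_pow (n := 3) ?_
    rw [← heq]
    exact dvd_sub (Dvd.dvd.mul_left (dvd_pow hpb two_ne_zero) _) (dvd_pow hpa two_ne_zero)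
  have h₁ := Int.dvd_coe_gcd (Int.natCast_dvd_natCast.mpr hpab) hpc
  rw [hgcd] at h₁
  exact hp'.not_isUnit (isUnit_of_dvd_one (by simpa using h₁))

theorem odd_two_mul_sq_sub_sq {a b c : ℤ} (hab : IsCoprime a b)
    (heq : 2 * b ^ 2 - a ^ 2 = c ^ 3) : Odd (2 * b ^ 2 - a ^ 2) := by
  rw [← Int.not_even_iff_odd]
  intro h
  have hc : Even c := by
    rw [heq] at h
    exact (Int.even_pow.mp h).1
  have ha : Even a := by
    have h₁ : Even (a ^ 2) := by
      have := (even_two_mul (b ^ 2)).sub h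
      simpa using this
    exact (Int.even_pow.mp h₁).1
  obtain ⟨k, rfl⟩ := hc
  obtain ⟨l, rfl⟩ := ha
  have hb : Even b := by
    have h₁ : Even (b ^ 2) := ⟨2 * k ^ 3 + l ^ 2, by linarith⟩
    exact (Int.even_pow.mp h₁).1
  have h₂ := hab.isUnit_of_dvd' (x := 2) ⟨l, by ring⟩ hb.two_dvd
  exact Int.prime_two.not_isUnit h₂


/-- **Lemma, part i)**: every primitive integer solution of `2b² - a² = c³` is given by
one of the two stated parametrizations, up to independent signs. -/
theorem param_two_b_sq_sub_a_sq_eq_c_cubed (a b c : ℤ)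
    (hgcd : Int.gcd (Int.gcd a b) c = 1) (heq : 2 * b ^ 2 - a ^ 2 = c ^ 3) :
    ∃ x y ε₁ ε₂ : ℤ, Int.gcd x y = 1 ∧ (ε₁ = 1 ∨ ε₁ = -1) ∧ (ε₂ = 1 ∨ ε₂ = -1) ∧
      ((a = ε₁ * (x ^ 3 + 6 * x * y ^ 2) ∧
        b = ε₂ * (3 * x ^ 2 * y + 2 * y ^ 3)) ∨
       (a = ε₁ * (x ^ 3 + 6 * x ^ 2 * y + 6 * x * y ^ 2 + 4 * y ^ 3) ∧
        b = ε₂ * (x ^ 3 + 3 * x ^ 2 * y + 6 * x * y ^ 2 + 2 * y ^ 3))) := by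
  have hab := isCoprime_of_two_mul_sq_sub_sq_eq_pow_three hgcd heq
  have h_cop := Zsqrtd.isCoprime_mk_mk_neg hab (odd_two_mul_sq_sub_sq hab heq)
  have h_mul : (⟨a, b⟩ * ⟨a, -b⟩ : ℤ√2) = ((-c : ℤ) : ℤ√2) ^ 3 := by
    rw [← Int.cast_pow]
    ext
    · simp only [Zsqrtd.re_mul, Zsqrtd.re_intCast]
      linear_combination -heq
    · simp only [Zsqrtd.im_mul, Zsqrtd.im_intCast]
      ring
  obtain ⟨d, u, hd⟩ := exists_associated_pow_of_mul_eq_pow' h_cop h_mul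
  obtain ⟨v, hv⟩ := Zsqrtd.exists_eq_pow_three_mul_of_isUnit u.isUnit
  have h_form : ∃ x y : ℤ, (⟨a, b⟩ : ℤ√2) = ⟨x, y⟩ ^ 3 ∨ (⟨a, b⟩ : ℤ√2) = ⟨1, 1⟩ * ⟨x, y⟩ ^ 3 ∨
      (⟨a, b⟩ : ℤ√2) = ⟨1, -1⟩ * ⟨x, y⟩ ^ 3 := by
    refine ⟨(d * v).re, (d * v).im, ?_⟩
    change _ = (d * v) ^ 3 ∨ _ = _ * (d * v) ^ 3 ∨ _ = _ * (d * v) ^ 3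
    rw [← hd]
    rcases hv with hv | hv | hv
    · left; rw [hv]; ring
    · right; left; rw [hv]; ring
    · right; right; rw [hv]; ring
  obtain ⟨x, y, h⟩ := h_form
  have h_cube : (⟨x, y⟩ : ℤ√2) ^ 3 = ⟨x ^ 3 + 6 * x * y ^ 2, 3 * x ^ 2 * y + 2 * y ^ 3⟩ := by
    ext <;> simp only [pow_succ, pow_zero, one_mul, Zsqrtd.re_mul, Zsqrtd.im_mul] <;> ring
  rw [h_cube] at h
  simp only [Zsqrtd.ext_iff, Zsqrtd.re_mul, Zsqrtd.im_mul] at h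
  have h_gcd : Int.gcd x y = 1 := by
    rw [← Int.isCoprime_iff_gcd_eq_one, ← isRelPrime_iff_isCoprime]
    intro e hex hey
    have h₁ : e ∣ x ^ 3 + 6 * x * y ^ 2 :=
      dvd_add (dvd_pow hex three_ne_zero) ((hex.mul_left _).mul_right _)
    have h₂ : e ∣ 3 * x ^ 2 * y + 2 * y ^ 3 :=
      dvd_add (hey.mul_left _) ((dvd_pow hey three_ne_zero).mul_left _)
    refine hab.isUnit_of_dvd' ?_ ?_
    · rcases h with h | h | h <;> rw [h.1]
      · exact h₁
      · exact dvd_add (h₁.mul_left _) (h₂.mul_left _)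
      · exact dvd_add (h₁.mul_left _) (h₂.mul_left _)
    · rcases h with h | h | h <;> rw [h.2]
      · exact h₂
      · exact dvd_add (h₂.mul_left _) (h₁.mul_left _)
      · exact dvd_add (h₂.mul_left _) (h₁.mul_left _)
  rcases h with ⟨ha, hb⟩ | ⟨ha, hb⟩ | ⟨ha, hb⟩
  · exact ⟨x, y, 1, 1, h_gcd, Or.inl rfl, Or.inl rfl, Or.inl ⟨by rw [ha]; ring, by rw [hb]; ring⟩⟩
  · exact ⟨x, y, 1, 1, h_gcd, Or.inl rfl, Or.inl rfl, Or.inr ⟨by rw [ha]; ring, by rw [hb]; ring⟩⟩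
  · exact ⟨x, -y, 1, -1, by rwa [Int.gcd_neg], Or.inl rfl, Or.inr rfl,
      Or.inr ⟨by rw [ha]; ring, by rw [hb]; ring⟩⟩
end

section
/- Let a, b, c be integers with gcd(a, b, c) = 1 satisfying a² + b² = 2c³. Then there exist coprime integers x, y and signs ε₁, ε₂ ∈ {1, -1} (chosen independently) such that a = ε₁(x³ - 3x²y - 3xy² + y³) and b = ε₂(x³ + 3x²y - 3xy² - y³). -/
/-- Every unit of `ℤ[i]` is a cube. -/
theorem GaussianInt.exists_pow_three_eq_of_isUnit {e : GaussianInt} (he : IsUnit e) :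
    ∃ s : GaussianInt, s ^ 3 = e := by
  refine ⟨star e, ?_⟩
  have hnorm : e.norm = 1 := (Zsqrtd.norm_eq_one_iff' (by norm_num) e).2 he
  obtain ⟨r, t⟩ := e
  rw [Zsqrtd.norm_def] at hnorm
  simp only at hnorm
  have hr : -1 ≤ r ∧ r ≤ 1 := by constructor <;> nlinarith [sq_nonneg t]
  have ht : -1 ≤ t ∧ t ≤ 1 := by constructor <;> nlinarith [sq_nonneg r]
  obtain ⟨hr₁, hr₂⟩ := hr
  obtain ⟨ht₁, ht₂⟩ := ht
  interval_cases r <;> interval_cases t <;> first | omega | decide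

/-- A Gaussian integer with coprime coordinates and odd norm is coprime to its conjugate. -/
theorem GaussianInt.isCoprime_star {z : GaussianInt} (h : IsCoprime z.re z.im)
    (hodd : Odd z.norm) : IsCoprime z (star z) := by
  obtain ⟨p, q, hpq⟩ := h
  obtain ⟨k, hk⟩ := hodd
  obtain ⟨u, v⟩ := z
  rw [Zsqrtd.norm_def] at hk
  simp only at hpq hk
  refine ⟨star ⟨u, v⟩ + ⟨-k * p, k * q⟩, ⟨-k * p, -k * q⟩, ?_⟩
  ext
  · simp
    linear_combination hk - 2 * k * hpq
  · simp
    ring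

/-- If `u² + v²` is an odd cube and `u`, `v` are coprime, then `u + vi` is a cube in `ℤ[i]`. -/
theorem GaussianInt.exists_eq_pow_three {u v c : ℤ} (h : IsCoprime u v) (hodd : Odd c)
    (heq : u ^ 2 + v ^ 2 = c ^ 3) :
    ∃ x y : ℤ, u = x ^ 3 - 3 * x * y ^ 2 ∧ v = 3 * x ^ 2 * y - y ^ 3 := by
  have hnorm : (⟨u, v⟩ : GaussianInt).norm = c ^ 3 := by
    rw [Zsqrtd.norm_def]
    linear_combination heq
  have hmul : (⟨u, v⟩ : GaussianInt) * star ⟨u, v⟩ = (c : GaussianInt) ^ 3 := by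
    rw [← Zsqrtd.norm_eq_mul_conj, hnorm]
    push_cast
    rfl
  have hcop : IsCoprime (⟨u, v⟩ : GaussianInt) (star ⟨u, v⟩) :=
    GaussianInt.isCoprime_star h (hnorm ▸ hodd.pow)
  obtain ⟨d, e, he⟩ := exists_associated_pow_of_mul_eq_pow' hcop hmul
  obtain ⟨s, hs⟩ := GaussianInt.exists_pow_three_eq_of_isUnit e.isUnit
  rw [← hs, ← mul_pow] at he
  generalize d * s = w at he
  obtain ⟨x, y⟩ := w
  rw [Zsqrtd.ext_iff] at he
  obtain ⟨hre, him⟩ := he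
  simp [pow_succ] at hre him
  exact ⟨x, y, by linear_combination -hre, by linear_combination -him⟩

/-- In a primitive solution of `a² + b² = 2c³`, the integers `a` and `b` are coprime. -/
theorem isCoprime_of_sq_add_sq_eq_two_mul_cube {a b c : ℤ}
    (hgcd : Int.gcd (Int.gcd a b) c = 1) (heq : a ^ 2 + b ^ 2 = 2 * c ^ 3) :
    IsCoprime a b := by
  rw [Int.isCoprime_iff_gcd_eq_one]
  by_contra hne
  obtain ⟨p, hp, hpg⟩ := Nat.exists_prime_and_dvd hne
  have hpi : Prime (p : ℤ) := Nat.prime_iff_prime_int.1 hp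
  have hpg' : (p : ℤ) ∣ (Int.gcd a b : ℤ) := Int.natCast_dvd_natCast.2 hpg
  have hc : ¬ (p : ℤ) ∣ c := fun hpc =>
    hpi.not_isUnit (isUnit_of_dvd_one (by simpa [hgcd] using Int.dvd_coe_gcd hpg' hpc))
  have hsq : (p : ℤ) ^ 2 ∣ 2 * c ^ 3 := heq ▸ dvd_add
    (pow_dvd_pow_of_dvd (hpg'.trans (Int.gcd_dvd_left ..)) 2)
    (pow_dvd_pow_of_dvd (hpg'.trans (Int.gcd_dvd_right ..)) 2)
  have hcop : IsCoprime ((p : ℤ) ^ 2) (c ^ 3) :=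
    ((hpi.irreducible.coprime_iff_not_dvd).2 hc).pow
  have hle := Int.le_of_dvd (by norm_num) (hcop.dvd_of_dvd_mul_right hsq)
  have hp2 : (2 : ℤ) ≤ p := by exact_mod_cast hp.two_le
  nlinarith

/-- **Lemma, part ii)**: every primitive integer solution of `a² + b² = 2c³` is given by
the stated parametrization, up to independent signs. -/
theorem param_a_sq_add_b_sq_eq_two_c_cubed (a b c : ℤ)
    (hgcd : Int.gcd (Int.gcd a b) c = 1) (heq : a ^ 2 + b ^ 2 = 2 * c ^ 3) :
    ∃ x y ε₁ ε₂ : ℤ, Int.gcd x y = 1 ∧ (ε₁ = 1 ∨ ε₁ = -1) ∧ (ε₂ = 1 ∨ ε₂ = -1) ∧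
      a = ε₁ * (x ^ 3 - 3 * x ^ 2 * y - 3 * x * y ^ 2 + y ^ 3) ∧
      b = ε₂ * (x ^ 3 + 3 * x ^ 2 * y - 3 * x * y ^ 2 - y ^ 3) := by
  obtain ⟨p, q, hpq⟩ := isCoprime_of_sq_add_sq_eq_two_mul_cube hgcd heq
  have hsum : Even (a + b) := by
    have h : Even (a ^ 2 + b ^ 2) := heq ▸ even_two_mul _
    simpa [Int.even_add, Int.even_pow] using h
  obtain ⟨u, hu⟩ := hsum
  obtain ⟨v, rfl⟩ : ∃ v, b = u + v := ⟨b - u, by ring⟩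
  obtain rfl : a = u - v := by linear_combination hu
  have huv : u ^ 2 + v ^ 2 = c ^ 3 := by linarith
  have hcop : IsCoprime u v := ⟨p + q, q - p, by linear_combination hpq⟩
  have hodd : Odd c := by
    have h : Odd (u + v) := by
      by_contra h
      obtain ⟨m, hm⟩ := Int.not_odd_iff_even.1 h
      have hunit : (2 : ℤ) ∣ 1 :=
        ⟨p * (m - v) + q * m, by linear_combination -hpq + (p + q) * hm⟩
      norm_num at hunit
    have h' : Odd (c ^ 3) := by
      rw [← huv]
      simpa [Int.odd_add, Int.odd_pow, Int.even_pow] using h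
    simpa [Int.odd_pow] using h'
  obtain ⟨x, y, rfl, rfl⟩ := GaussianInt.exists_eq_pow_three hcop hodd huv
  refine ⟨x, y, 1, 1, ?_, Or.inl rfl, Or.inl rfl, by ring, by ring⟩
  obtain ⟨r, s, hrs⟩ := hcop
  exact Int.isCoprime_iff_gcd_eq_one.1
    ⟨r * (x ^ 2 - 3 * y ^ 2), s * (3 * x ^ 2 - y ^ 2), by linear_combination hrs⟩
end

section
/- Let a, b, c be integers with gcd(a, b, c) = 1 satisfying a² + 2b² = 3c³. Then there exist coprime integers x, y and signs ε₁, ε₂ ∈ {1, -1} (chosen independently) such that a = ε₁(x³ - 6x²y - 6xy² + 4y³) and b = ε₂(x³ + 3x²y - 6xy² - 2y³). -/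
namespace Zsqrtd

theorem exists_norm_sub_mul_lt (z : ℤ√(-2)) {w : ℤ√(-2)} (hw : w ≠ 0) :
    ∃ q, (z - w * q).norm < w.norm := by
  have hpos : 0 < w.norm :=
    lt_of_le_of_ne (norm_nonneg (by norm_num) w)
      fun h ↦ hw ((norm_eq_zero_iff (by norm_num) w).1 h.symm)
  have nearest (m : ℤ) : ∃ q, |2 * (m - w.norm * q)| ≤ w.norm := by
    refine ⟨(2 * m + w.norm) / (2 * w.norm), ?_⟩
    have h₁ := Int.emod_add_mul_ediv (2 * m + w.norm) (2 * w.norm)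
    have h₂ := Int.emod_nonneg (2 * m + w.norm) (b := 2 * w.norm) (by lia)
    have h₃ := Int.emod_lt_of_pos (2 * m + w.norm) (b := 2 * w.norm) (by lia)
    rw [abs_le]
    constructor <;> linarith
  obtain ⟨q₁, h₁⟩ := nearest (z * star w).re
  obtain ⟨q₂, h₂⟩ := nearest (z * star w).im
  refine ⟨⟨q₁, q₂⟩, ?_⟩
  have hmul : (z - w * ⟨q₁, q₂⟩).norm * w.norm =
      ((z * star w).re - w.norm * q₁) ^ 2 + 2 * ((z * star w).im - w.norm * q₂) ^ 2 := by
    simp only [norm_def, re_sub, im_sub, re_mul, im_mul, re_star, im_star]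
    ring
  have h₁' := sq_le_sq' (abs_le.1 h₁).1 (abs_le.1 h₁).2
  have h₂' := sq_le_sq' (abs_le.1 h₂).1 (abs_le.1 h₂).2
  nlinarith

noncomputable instance euclideanDomainNegTwo : EuclideanDomain (ℤ√(-2)) :=
  { (inferInstance : CommRing (ℤ√(-2))), (inferInstance : Nontrivial (ℤ√(-2))) with
    quotient := fun z w ↦
      open Classical in if hw : w = 0 then 0 else (exists_norm_sub_mul_lt z hw).choose
    quotient_zero := fun _ ↦ dif_pos rfl
    remainder := fun z w ↦
      z - w * open Classical in if hw : w = 0 then 0 else (exists_norm_sub_mul_lt z hw).choose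
    quotient_mul_add_remainder_eq := fun _ _ ↦ add_sub_cancel _ _
    r := fun z w ↦ z.norm.natAbs < w.norm.natAbs
    r_wellFounded := (measure fun z : ℤ√(-2) ↦ z.norm.natAbs).wf
    remainder_lt := fun z w hw ↦ by
      have h := (exists_norm_sub_mul_lt z hw).choose_spec
      have h₀ := norm_nonneg (by norm_num) (z - w * (exists_norm_sub_mul_lt z hw).choose)
      simp only [dif_neg hw]
      lia
    mul_left_not_lt := fun z w hw ↦ by
      have hpos : 0 < w.norm.natAbs :=
        Int.natAbs_pos.2 fun h ↦ hw ((norm_eq_zero_iff (by norm_num) w).1 h)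
      rw [norm_mul, Int.natAbs_mul, not_lt]
      exact Nat.le_mul_of_pos_right _ hpos }

theorem eq_one_or_neg_one_of_isUnit {u : ℤ√(-2)} (hu : IsUnit u) : u = 1 ∨ u = -1 := by
  have h := (norm_eq_one_iff' (by norm_num) u).2 hu
  rw [norm_def] at h
  have him : u.im = 0 := by nlinarith [mul_self_nonneg u.re]
  have hre : u.re * u.re = 1 := by rw [him] at h; linarith
  rcases mul_self_eq_one_iff.1 hre with h | h
  · exact .inl (Zsqrtd.ext h him)
  · exact .inr (Zsqrtd.ext h (by simpa using him))

theorem exists_eq_cube_of_norm_eq_cube {z : ℤ√(-2)} {c : ℤ} (hz : IsCoprime z.re z.im)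
    (hc : Odd c) (hnorm : z.norm = c ^ 3) : ∃ w, z = w ^ 3 := by
  have hN : z.norm = z.re ^ 2 + 2 * z.im ^ 2 := by rw [norm_def]; ring
  have hodd : IsCoprime (2 : ℤ) z.norm := by
    rw [hnorm]
    exact (Int.isCoprime_two_left.2 hc).pow_right
  have hre2 : IsCoprime z.re 2 := by
    have : IsCoprime 2 (z.re * z.re) := by
      have := hodd.add_mul_left_right (-z.im ^ 2)
      rwa [show z.norm + 2 * -z.im ^ 2 = z.re * z.re by rw [hN]; ring] at this
    exact this.of_mul_right_left.symm
  have hre : IsCoprime z.re z.norm := by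
    have := (hre2.mul_right (hz.pow_right (n := 2))).add_mul_left_right z.re
    rwa [show 2 * z.im ^ 2 + z.re * z.re = z.norm by rw [hN]; ring] at this
  obtain ⟨r, t, hrt⟩ := hodd.mul_left hre
  have hsum : ((2 * z.re : ℤ) : ℤ√(-2)) = z + star z := by
    ext <;> simp
    ring
  have hcop : IsCoprime z (star z) := by
    refine ⟨r + t * star z, r, ?_⟩
    have := congrArg (Int.cast : ℤ → ℤ√(-2)) hrt
    rw [Int.cast_add, Int.cast_mul r, Int.cast_mul t, hsum, norm_eq_mul_conj, Int.cast_one] at this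
    rw [← this]
    ring
  have hprod : z * star z = (c : ℤ√(-2)) ^ 3 := by
    rw [← norm_eq_mul_conj, hnorm, Int.cast_pow]
  obtain ⟨w, u, hu⟩ := exists_associated_pow_of_mul_eq_pow' hcop hprod
  rcases eq_one_or_neg_one_of_isUnit u.isUnit with h | h
  · exact ⟨w, by rw [← hu, h, mul_one]⟩
  · exact ⟨-w, by rw [← hu, h]; ring⟩

end Zsqrtd

theorem isCoprime_and_odd_of_sq_add_two_mul_sq_eq_three_mul_cube {a b c : ℤ}
    (hgcd : Int.gcd (Int.gcd a b) c = 1) (heq : a ^ 2 + 2 * b ^ 2 = 3 * c ^ 3) :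
    IsCoprime a b ∧ Odd c := by
  have hab : IsCoprime a b := by
    rw [Int.isCoprime_iff_gcd_eq_one]
    by_contra h
    obtain ⟨p, hp, hpd⟩ := Nat.exists_prime_and_dvd h
    have hpd' : (p : ℤ) ∣ (Int.gcd a b : ℤ) := Int.natCast_dvd_natCast.2 hpd
    have hpZ : Prime (p : ℤ) := Nat.prime_iff_prime_int.1 hp
    have hpc : ¬ (p : ℤ) ∣ c := fun hc ↦
      hp.one_lt.ne' (Nat.dvd_one.1 (hgcd ▸ Int.dvd_gcd hpd' hc))
    have hsq : (p : ℤ) ^ 2 ∣ 3 * c ^ 3 := by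
      rw [← heq]
      exact dvd_add (pow_dvd_pow_of_dvd (hpd'.trans (Int.gcd_dvd_left ..)) 2)
        ((pow_dvd_pow_of_dvd (hpd'.trans (Int.gcd_dvd_right ..)) 2).mul_left 2)
    have hcop : IsCoprime ((p : ℤ) ^ 2) (c ^ 3) :=
      ((hpZ.coprime_iff_not_dvd).2 hpc).pow
    have h₃ := Int.le_of_dvd (by norm_num) (hcop.dvd_of_dvd_mul_right hsq)
    have hp₂ : (2 : ℤ) ≤ p := by exact_mod_cast hp.two_le
    nlinarith
  refine ⟨hab, ?_⟩
  by_contra hc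
  obtain ⟨k, rfl⟩ := even_iff_two_dvd.1 (Int.not_odd_iff_even.1 hc)
  have ha : (2 : ℤ) ∣ a :=
    Int.prime_two.dvd_of_dvd_pow (n := 2) ⟨12 * k ^ 3 - b ^ 2, by linarith⟩
  obtain ⟨m, rfl⟩ := ha
  have hb : (2 : ℤ) ∣ b :=
    Int.prime_two.dvd_of_dvd_pow (n := 2) ⟨6 * k ^ 3 - m ^ 2, by linarith⟩
  have := hab.isUnit_of_dvd' (dvd_mul_right 2 m) hb
  exact Int.prime_two.not_isUnit this

theorem exists_param_of_three_dvd_sub {a b c : ℤ} (hab : IsCoprime a b) (hc : Odd c)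
    (heq : a ^ 2 + 2 * b ^ 2 = 3 * c ^ 3) (hdvd : 3 ∣ b - a) :
    ∃ x y : ℤ, Int.gcd x y = 1 ∧ a = x ^ 3 - 6 * x ^ 2 * y - 6 * x * y ^ 2 + 4 * y ^ 3 ∧
      b = x ^ 3 + 3 * x ^ 2 * y - 6 * x * y ^ 2 - 2 * y ^ 3 := by
  obtain ⟨v, hv⟩ := hdvd
  obtain ⟨u, rfl⟩ : ∃ u, a = u - 2 * v := ⟨a + 2 * v, by ring⟩
  obtain rfl : b = u + v := by linarith
  have huv : IsCoprime u v := by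
    obtain ⟨r, s, h⟩ := hab
    exact ⟨r + s, s - 2 * r, by rw [← h]; ring⟩
  obtain ⟨⟨x, y⟩, hw⟩ := Zsqrtd.exists_eq_cube_of_norm_eq_cube (z := ⟨u, v⟩) (c := c) huv hc
    (by rw [Zsqrtd.norm_def]; linarith)
  have hcop : IsCoprime x y :=
    Zsqrtd.isCoprime_of_dvd_isCoprime (a := ⟨u, v⟩) (b := ⟨x, y⟩) huv
      (hw ▸ dvd_pow_self _ three_ne_zero)
  have hre := congrArg Zsqrtd.re hw
  have him := congrArg Zsqrtd.im hw
  simp only [pow_succ, pow_zero, one_mul, Zsqrtd.re_mul, Zsqrtd.im_mul] at hre him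
  refine ⟨x, y, Int.isCoprime_iff_gcd_eq_one.1 hcop, ?_, ?_⟩ <;> rw [hre, him] <;> ring

/-- **Lemma, part iii)**: every primitive integer solution of `a² + 2b² = 3c³` is given
by the stated parametrization, up to independent signs. -/
theorem param_a_sq_add_two_b_sq_eq_three_c_cubed (a b c : ℤ)
    (hgcd : Int.gcd (Int.gcd a b) c = 1) (heq : a ^ 2 + 2 * b ^ 2 = 3 * c ^ 3) :
    ∃ x y ε₁ ε₂ : ℤ, Int.gcd x y = 1 ∧ (ε₁ = 1 ∨ ε₁ = -1) ∧ (ε₂ = 1 ∨ ε₂ = -1) ∧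
      a = ε₁ * (x ^ 3 - 6 * x ^ 2 * y - 6 * x * y ^ 2 + 4 * y ^ 3) ∧
      b = ε₂ * (x ^ 3 + 3 * x ^ 2 * y - 6 * x * y ^ 2 - 2 * y ^ 3) := by
  obtain ⟨hab, hc⟩ := isCoprime_and_odd_of_sq_add_two_mul_sq_eq_three_mul_cube hgcd heq
  have hdvd : (3 : ℤ) ∣ (b - a) * (-b - a) := ⟨c ^ 3 - b ^ 2, by linarith⟩
  rcases Int.prime_three.dvd_or_dvd hdvd with h | h
  · obtain ⟨x, y, hxy, ha, hb⟩ := exists_param_of_three_dvd_sub hab hc heq h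
    exact ⟨x, y, 1, 1, hxy, .inl rfl, .inl rfl, by rw [one_mul, ← ha], by rw [one_mul, ← hb]⟩
  · obtain ⟨x, y, hxy, ha, hb⟩ :=
      exists_param_of_three_dvd_sub hab.neg_right hc (by rwa [neg_sq]) h
    exact ⟨x, y, 1, -1, hxy, .inl rfl, .inr rfl, by rw [one_mul, ← ha], by rw [← hb]; ring⟩
end

section
/- Let a, b, c be integers with gcd(a, b, c) = 1 satisfying 3b² - a² = 2c³. Then there exist coprime integers x, y and signs ε₁, ε₂ ∈ {1, -1} (chosen independently) such that either a = ε₁(x³ + 9x²y + 9xy² + 9y³) and b = ε₂(x³ + 3x²y + 9xy² + 3y³), or a = ε₁(5x³ + 27x²y + 45xy² + 27y³) and b = ε₂(3x³ + 15x²y + 27xy² + 15y³). -/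
/-- Division with remainder in `ℤ√3` with respect to the absolute value of the norm. -/
theorem Zsqrtd.exists_norm_sub_mul_lt_s6 (a b : ℤ√3) (hb : b.norm ≠ 0) :
    ∃ q : ℤ√3, |(a - b * q).norm| < |b.norm| := by
  have nearest : ∀ u N : ℤ, N ≠ 0 → ∃ q : ℤ, (2 * (u - N * q)) ^ 2 ≤ N ^ 2 := by
    intro u N hN
    refine ⟨round (u / N : ℚ), ?_⟩
    have hN' : (N : ℚ) ≠ 0 := by exact_mod_cast hN
    have h := abs_sub_round (u / N : ℚ)
    rw [abs_le] at h
    have hr : (2 * ((u : ℚ) - N * round (u / N : ℚ))) ^ 2 ≤ (N : ℚ) ^ 2 := by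
      have e : 2 * ((u : ℚ) - N * round (u / N : ℚ))
          = N * (2 * (u / N - round (u / N : ℚ))) := by field_simp
      rw [e, mul_pow]
      have : (2 * ((u : ℚ) / N - round (u / N : ℚ))) ^ 2 ≤ 1 := by nlinarith
      nlinarith [sq_nonneg (N : ℚ)]
    exact_mod_cast hr
  obtain ⟨p, hp⟩ := nearest (a * star b).re b.norm hb
  obtain ⟨q, hq⟩ := nearest (a * star b).im b.norm hb
  refine ⟨⟨p, q⟩, ?_⟩
  set N := b.norm with hN
  have key : (a - b * ⟨p, q⟩).norm * N =
      ((a * star b).re - N * p) ^ 2 - 3 * ((a * star b).im - N * q) ^ 2 := by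
    simp only [hN, Zsqrtd.norm_def, Zsqrtd.re_sub, Zsqrtd.im_sub, Zsqrtd.re_mul, Zsqrtd.im_mul,
      Zsqrtd.re_star, Zsqrtd.im_star]
    ring
  have hpos : 0 < N ^ 2 := by positivity
  have hlt : |(a - b * ⟨p, q⟩).norm * N| < N ^ 2 := by
    rw [key, abs_lt]
    constructor <;> nlinarith [sq_nonneg ((a * star b).re - N * p),
      sq_nonneg ((a * star b).im - N * q)]
  rw [abs_mul, ← sq_abs, sq] at hlt
  exact lt_of_mul_lt_mul_right hlt (abs_nonneg N)

theorem Zsqrtd.three_ne_mul_self (n : ℤ) : (3 : ℤ) ≠ n * n := by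
  intro h
  have h1 : n < 2 := by nlinarith
  have h2 : -2 < n := by nlinarith
  interval_cases n <;> omega

instance Zsqrtd.isDomain_three : IsDomain (ℤ√3) :=
  haveI : Zsqrtd.Nonsquare 3 :=
    ⟨fun n h => Zsqrtd.three_ne_mul_self n (by exact_mod_cast h)⟩
  inferInstanceAs (IsDomain (ℤ√((3 : ℕ) : ℤ)))

theorem Zsqrtd.norm_ne_zero_three {b : ℤ√3} (hb : b ≠ 0) : b.norm ≠ 0 :=
  mt (Zsqrtd.norm_eq_zero Zsqrtd.three_ne_mul_self b).mp hb

instance Zsqrtd.isPrincipalIdealRing_three : IsPrincipalIdealRing (ℤ√3) where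
  principal I := by
    by_cases hI : I = ⊥
    · rw [hI]
      infer_instance
    obtain ⟨b₀, hb₀, hb₀'⟩ := Submodule.exists_mem_ne_zero_of_ne_bot hI
    obtain ⟨b, ⟨hbI, hb⟩, hmin⟩ := exists_minimalFor_of_wellFoundedLT
      (fun b : ℤ√3 => b ∈ I ∧ b ≠ 0) (fun b => b.norm.natAbs) ⟨b₀, hb₀, hb₀'⟩
    refine ⟨b, _root_.le_antisymm (fun a ha => ?_) ?_⟩
    · obtain ⟨q, hq⟩ := Zsqrtd.exists_norm_sub_mul_lt_s6 a b (Zsqrtd.norm_ne_zero_three hb)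
      have hr : a - b * q = 0 := by
        by_contra hne
        have := hmin ⟨I.sub_mem ha (I.mul_mem_right q hbI), hne⟩
        simp only [Int.abs_eq_natAbs] at this hq
        omega
      exact Ideal.mem_span_singleton'.mpr ⟨q, by linear_combination -hr⟩
    · exact (Ideal.span_singleton_le_iff_mem I).mpr hbI

/-- Every unit of `ℤ√3` is, up to a cube, one of `1`, `2 + √3` and `2 - √3`. -/
theorem Zsqrtd.exists_unit_eq_cube_mul (u : (ℤ√3)ˣ) :
    ∃ v r : ℤ√3, (u : ℤ√3) = v ^ 3 * r ∧ (r = 1 ∨ r = ⟨2, 1⟩ ∨ r = ⟨2, -1⟩) := by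
  have hnorm : (u : ℤ√3).re ^ 2 - 3 * (u : ℤ√3).im ^ 2 = 1 := by
    have h := (Zsqrtd.isUnit_iff_norm_isUnit (u : ℤ√3)).mp u.isUnit
    have e : (u : ℤ√3).norm = (u : ℤ√3).re ^ 2 - 3 * (u : ℤ√3).im ^ 2 := by
      rw [Zsqrtd.norm_def]
      ring
    rw [e] at h
    rcases Int.isUnit_iff.mp h with h | h
    · exact h
    · exfalso
      have h3 : (u : ℤ√3).re ^ 2 % 3 = 2 := by omega
      have : (u : ℤ√3).re % 3 = 0 ∨ (u : ℤ√3).re % 3 = 1 ∨ (u : ℤ√3).re % 3 = 2 := by omega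
      rcases this with h' | h' | h' <;> simp [pow_two, Int.mul_emod, h'] at h3
  let f : Pell.Solution₁ 3 := .mk 2 1 (by norm_num)
  have hf : Pell.IsFundamental f := by
    refine ⟨by simp [f], by simp [f], fun {b} hb => ?_⟩
    simp only [f, Pell.Solution₁.x_mk]
    omega
  obtain ⟨n, hn⟩ := hf.eq_zpow_or_neg_zpow (.mk (u : ℤ√3).re (u : ℤ√3).im hnorm)
  obtain ⟨k, r, hnr, hr⟩ : ∃ k r : ℤ, n = k * 3 + r ∧ (r = 0 ∨ r = 1 ∨ r = -1) := by
    refine ⟨(n + 1) / 3, n - (n + 1) / 3 * 3, by ring, by omega⟩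
  have hfn : f ^ n = (f ^ k) ^ 3 * f ^ r := by
    rw [hnr, zpow_add, zpow_mul]
    norm_cast
  have hfr : ((f ^ r : Pell.Solution₁ 3) : ℤ√3) = 1 ∨
      ((f ^ r : Pell.Solution₁ 3) : ℤ√3) = ⟨2, 1⟩ ∨
      ((f ^ r : Pell.Solution₁ 3) : ℤ√3) = ⟨2, -1⟩ := by
    rcases hr with rfl | rfl | rfl
    · left; rfl
    · right; left; simp [f]
    · right; right
      rw [zpow_neg_one]
      rfl
  have hu : (u : ℤ√3) =
      ((.mk (u : ℤ√3).re (u : ℤ√3).im hnorm : Pell.Solution₁ 3) : ℤ√3) := rfl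
  rcases hn with hn | hn
  · refine ⟨((f ^ k : Pell.Solution₁ 3) : ℤ√3), _, ?_, hfr⟩
    rw [hu, hn, hfn]
    rfl
  · refine ⟨-((f ^ k : Pell.Solution₁ 3) : ℤ√3), _, ?_, hfr⟩
    rw [hu, hn, hfn, Odd.neg_pow (by decide), neg_mul]
    rfl

/-- If `s` and `t` are coprime and the norm of `s + t√3` is a cube coprime to `6`, then
`s + t√3` is a cube up to one of the units `1`, `2 + √3` and `2 - √3`. -/
theorem Zsqrtd.exists_eq_cube_mul_of_norm_eq_cube {s t c : ℤ} (hst : IsCoprime s t)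
    (hc : IsCoprime 6 (c ^ 3)) (h : s ^ 2 - 3 * t ^ 2 = c ^ 3) :
    ∃ e r : ℤ√3, (⟨s, t⟩ : ℤ√3) = e ^ 3 * r ∧ (r = 1 ∨ r = ⟨2, 1⟩ ∨ r = ⟨2, -1⟩) := by
  have hmul : (⟨s, t⟩ : ℤ√3) * ⟨s, -t⟩ = (c : ℤ√3) ^ 3 := by
    rw [← Int.cast_pow, ← h]
    ext
    · rw [Zsqrtd.re_intCast]
      simp
      ring
    · rw [Zsqrtd.im_intCast]
      simp
      ring
  have hcop : IsCoprime (⟨s, t⟩ : ℤ√3) ⟨s, -t⟩ := by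
    obtain ⟨m, n, hmn⟩ := hst
    obtain ⟨p, q, hpq⟩ := hc
    refine ⟨p * ⟨3 * m, n⟩ + q * ⟨s, -t⟩, p * ⟨3 * m, -n⟩, ?_⟩
    ext
    · simp
      linear_combination hpq + 6 * p * hmn + q * h
    · simp
      ring
  obtain ⟨d, u, hu⟩ := exists_associated_pow_of_mul_eq_pow' hcop hmul
  obtain ⟨v, r, hvr, hr⟩ := Zsqrtd.exists_unit_eq_cube_mul u
  exact ⟨d * v, r, by rw [← hu, hvr]; ring, hr⟩


/-- **Lemma, part iv)**: every primitive integer solution of `3b² - a² = 2c³` is given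
by one of the two stated parametrizations, up to independent signs. -/
theorem param_three_b_sq_sub_a_sq_eq_two_c_cubed (a b c : ℤ)
    (hgcd : Int.gcd (Int.gcd a b) c = 1) (heq : 3 * b ^ 2 - a ^ 2 = 2 * c ^ 3) :
    ∃ x y ε₁ ε₂ : ℤ, Int.gcd x y = 1 ∧ (ε₁ = 1 ∨ ε₁ = -1) ∧ (ε₂ = 1 ∨ ε₂ = -1) ∧
      ((a = ε₁ * (x ^ 3 + 9 * x ^ 2 * y + 9 * x * y ^ 2 + 9 * y ^ 3) ∧
        b = ε₂ * (x ^ 3 + 3 * x ^ 2 * y + 9 * x * y ^ 2 + 3 * y ^ 3)) ∨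
       (a = ε₁ * (5 * x ^ 3 + 27 * x ^ 2 * y + 45 * x * y ^ 2 + 27 * y ^ 3) ∧
        b = ε₂ * (3 * x ^ 3 + 15 * x ^ 2 * y + 27 * x * y ^ 2 + 15 * y ^ 3))) := by
  have hprime : ∀ p : ℤ, Prime p → p ∣ a → p ∣ b → p ∣ c → False := by
    intro p hp ha hb hc
    have h1 : p ∣ ((Int.gcd (Int.gcd a b) c : ℕ) : ℤ) :=
      Int.dvd_coe_gcd (Int.dvd_coe_gcd ha hb) hc
    rw [hgcd] at h1
    exact hp.not_isUnit (isUnit_of_dvd_one (by exact_mod_cast h1))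
  have h2c : ¬ (2 : ℤ) ∣ c := by
    rintro ⟨k, rfl⟩
    rcases Int.even_or_odd' a with ⟨m, rfl | rfl⟩ <;>
      rcases Int.even_or_odd' b with ⟨n, rfl | rfl⟩
    · exact hprime 2 Int.prime_two ⟨m, rfl⟩ ⟨n, rfl⟩ ⟨k, rfl⟩
    all_goals ring_nf at heq; omega
  have h3c : ¬ (3 : ℤ) ∣ c := by
    intro hc
    have ha : (3 : ℤ) ∣ a := by
      obtain ⟨k, rfl⟩ := hc
      exact Int.prime_three.dvd_of_dvd_pow
        (⟨b ^ 2 - 18 * k ^ 3, by linear_combination -heq⟩ : (3 : ℤ) ∣ a ^ 2)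
    have hb : (3 : ℤ) ∣ b := by
      obtain ⟨k, rfl⟩ := hc
      obtain ⟨m, rfl⟩ := ha
      exact Int.prime_three.dvd_of_dvd_pow
        (⟨m ^ 2 + 6 * k ^ 3, by linarith⟩ : (3 : ℤ) ∣ b ^ 2)
    exact hprime 3 Int.prime_three ha hb hc
  obtain ⟨t, s, rfl, rfl⟩ : ∃ t s : ℤ, a = s + 3 * t ∧ b = s + t := by
    obtain ⟨k, hk⟩ : Even (a - b) := by
      have h : Even (a ^ 2 - b ^ 2) := ⟨b ^ 2 - c ^ 3, by linear_combination -heq⟩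
      simpa [Int.even_sub, Int.even_pow] using h
    exact ⟨k, b - k, by linarith, by ring⟩
  have hn : s ^ 2 - 3 * t ^ 2 = c ^ 3 := by linarith
  have hst : IsCoprime s t := by
    refine isCoprime_of_prime_dvd ?_ fun p hp hps hpt => ?_
    · rintro ⟨rfl, rfl⟩
      have hc : c = 0 := pow_eq_zero_iff three_ne_zero |>.mp (by simpa using hn.symm)
      exact h2c (hc ▸ dvd_zero 2)
    · refine hprime p hp (dvd_add hps (hpt.mul_left 3)) (dvd_add hps hpt)
        (hp.dvd_of_dvd_pow (n := 3) ?_)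
      rw [← hn]
      exact dvd_sub (dvd_pow hps two_ne_zero) ((dvd_pow hpt two_ne_zero).mul_left 3)
  have hc6 : IsCoprime 6 (c ^ 3) := by
    have h2 := (Int.prime_two.coprime_iff_not_dvd).mpr h2c
    have h3 := (Int.prime_three.coprime_iff_not_dvd).mpr h3c
    exact (show (6 : ℤ) = 2 * 3 by norm_num) ▸ (h2.mul_left h3).pow_right
  obtain ⟨⟨x, y⟩, r, he, hr⟩ := Zsqrtd.exists_eq_cube_mul_of_norm_eq_cube hst hc6 hn
  have hs := congrArg Zsqrtd.re he
  have ht := congrArg Zsqrtd.im he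
  simp only [pow_succ, pow_zero, one_mul, Zsqrtd.re_mul, Zsqrtd.im_mul] at hs ht
  have hxy : Int.gcd x y = 1 := by
    refine Int.isCoprime_iff_gcd_eq_one.mp
      (isCoprime_of_prime_dvd ?_ fun p hp hpx hpy => ?_)
    · rintro ⟨rfl, rfl⟩
      simp at hs ht
      exact not_isCoprime_zero_zero (hs ▸ ht ▸ hst)
    · have hpe : (p : ℤ√3) ∣ ⟨x, y⟩ := (Zsqrtd.intCast_dvd p _).mpr ⟨hpx, hpy⟩
      have hpst : (p : ℤ√3) ∣ ⟨s, t⟩ := he ▸ (dvd_pow hpe three_ne_zero).mul_right r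
      obtain ⟨hps, hpt⟩ := (Zsqrtd.intCast_dvd p _).mp hpst
      exact hp.not_isUnit (hst.isUnit_of_dvd' hps hpt)
  rcases hr with rfl | rfl | rfl
  · refine ⟨x, y, 1, 1, hxy, .inl rfl, .inl rfl, .inl ⟨?_, ?_⟩⟩ <;> rw [hs, ht] <;> simp <;> ring
  · refine ⟨x, y, 1, 1, hxy, .inl rfl, .inl rfl, .inr ⟨?_, ?_⟩⟩ <;> rw [hs, ht] <;> simp <;> ring
  · refine ⟨x, -y, -1, 1, by simpa using hxy, .inr rfl, .inl rfl, .inl ⟨?_, ?_⟩⟩ <;>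
      rw [hs, ht] <;> simp <;> ring
end

section
/- Let a, b, c be integers with gcd(a, b, c) = 1 satisfying 3b² - 2a² = c³. Then there exist coprime integers x, y and signs ε₁, ε₂ ∈ {1, -1} (chosen independently) such that either a = ε₁(x³ + 9x²y + 18xy² + 18y³) and b = ε₂(x³ + 6x²y + 18xy² + 12y³), or a = ε₁(11x³ + 81x²y + 198xy² + 162y³) and b = ε₂(9x³ + 66x²y + 162xy² + 132y³). -/
/-- The covering inequality behind the norm-Euclidean algorithm on `ℤ√6`, on a fundamental
domain. -/
lemma exists_abs_sub_mul_sq_lt_of_nonneg {A B N : ℤ} (hN : 0 < N) (hA : 0 ≤ A) (hAN : 2 * A ≤ N)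
    (hB : 0 ≤ B) (hBN : 2 * B ≤ N) :
    ∃ u v : ℤ, |(A - u * N) ^ 2 - 6 * (B - v * N) ^ 2| < N ^ 2 := by
  have hA2 : 4 * A ^ 2 ≤ N ^ 2 := by nlinarith
  have hB2 : 4 * B ^ 2 ≤ N ^ 2 := by nlinarith
  have hN2 : 0 < N ^ 2 := by positivity
  by_cases h₁ : 6 * B ^ 2 < A ^ 2 + N ^ 2
  · exact ⟨0, 0, abs_lt.2 ⟨by linarith, by nlinarith [sq_nonneg B]⟩⟩
  by_cases h₂ : (A + N) ^ 2 - 6 * B ^ 2 < N ^ 2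
  · exact ⟨-1, 0, abs_lt.2 ⟨by nlinarith, by linarith⟩⟩
  have hA' : 2 * A = N := by
    have : N ≤ 2 * A := by
      by_contra! h
      nlinarith
    omega
  subst hA'
  have hB' : 6 * B ^ 2 = 5 * A ^ 2 := by linarith
  have h₃ : 2 * A < 3 * B := by nlinarith
  exact ⟨-1, 1, abs_lt.2 ⟨by nlinarith, by nlinarith⟩⟩

/-- Division with remainder of at most half the modulus, up to sign. -/
lemma exists_eq_mul_add_sign_mul (A : ℤ) {N : ℤ} (hN : 0 < N) :
    ∃ u e r : ℤ, (e = 1 ∨ e = -1) ∧ A = u * N + e * r ∧ 0 ≤ r ∧ 2 * r ≤ N := by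
  have h := Int.emod_add_mul_ediv A N
  have h₀ := Int.emod_nonneg A hN.ne'
  have h₁ := Int.emod_lt_of_pos A hN
  by_cases h₂ : 2 * (A % N) ≤ N
  · exact ⟨A / N, 1, A % N, .inl rfl, by linarith, h₀, h₂⟩
  · exact ⟨A / N + 1, -1, N - A % N, .inr rfl, by linarith, by linarith, by linarith⟩

lemma exists_abs_sub_mul_sq_lt (A B : ℤ) {N : ℤ} (hN : N ≠ 0) :
    ∃ u v : ℤ, |(A - u * N) ^ 2 - 6 * (B - v * N) ^ 2| < N ^ 2 := by
  wlog hpos : 0 < N generalizing N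
  · obtain ⟨u, v, h⟩ := this (neg_ne_zero.2 hN) (by omega)
    exact ⟨-u, -v, by simpa using h⟩
  obtain ⟨u₁, e₁, r₁, he₁, rfl, h₁, h₁'⟩ := exists_eq_mul_add_sign_mul A hpos
  obtain ⟨u₂, e₂, r₂, he₂, rfl, h₂, h₂'⟩ := exists_eq_mul_add_sign_mul B hpos
  obtain ⟨u, v, h⟩ := exists_abs_sub_mul_sq_lt_of_nonneg hpos h₁ h₁' h₂ h₂'
  refine ⟨u₁ + e₁ * u, u₂ + e₂ * v, ?_⟩
  convert h using 3
  · rcases he₁ with rfl | rfl <;> ring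
  · rcases he₂ with rfl | rfl <;> ring

namespace Zsqrtd

lemma norm_sqrt_six_eq_zero {a : ℤ√6} : a.norm = 0 ↔ a = 0 :=
  norm_eq_zero (fun n h ↦ by
    have h₁ : n < 3 := by nlinarith
    have h₂ : -3 < n := by nlinarith
    interval_cases n <;> omega) a

lemma exists_natAbs_norm_sub_mul_lt_s7 (a : ℤ√6) {b : ℤ√6} (hb : b ≠ 0) :
    ∃ q : ℤ√6, (a - b * q).norm.natAbs < b.norm.natAbs := by
  have hN : b.norm ≠ 0 := mt norm_sqrt_six_eq_zero.1 hb
  obtain ⟨u, v, h⟩ := exists_abs_sub_mul_sq_lt (a * star b).re (a * star b).im hN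
  refine ⟨⟨u, v⟩, ?_⟩
  have key : ((a * star b).re - u * b.norm) ^ 2 - 6 * ((a * star b).im - v * b.norm) ^ 2 =
      (a - b * ⟨u, v⟩).norm * b.norm := by
    simp only [norm_def, re_mul, im_mul, re_sub, im_sub, re_star, im_star]
    ring
  rw [key, abs_mul, ← sq_abs, sq] at h
  zify
  exact lt_of_mul_lt_mul_right h (abs_nonneg _)

noncomputable instance : EuclideanDomain (ℤ√6) :=
  { (inferInstance : CommRing (ℤ√6)), (inferInstance : Nontrivial (ℤ√6)) with
    quotient a b := open Classical in
      if hb : b = 0 then 0 else (exists_natAbs_norm_sub_mul_lt_s7 a hb).choose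
    remainder a b := open Classical in
      a - b * if hb : b = 0 then 0 else (exists_natAbs_norm_sub_mul_lt_s7 a hb).choose
    quotient_zero _ := dif_pos rfl
    quotient_mul_add_remainder_eq _ _ := by ring
    r := _
    r_wellFounded := (measure fun a : ℤ√6 ↦ a.norm.natAbs).wf
    remainder_lt a b hb := by
      simp only [dif_neg hb]
      exact (exists_natAbs_norm_sub_mul_lt_s7 a hb).choose_spec
    mul_left_not_lt a b hb := by
      have : b.norm.natAbs ≠ 0 := by simpa [norm_sqrt_six_eq_zero] using hb
      change ¬ (a * b).norm.natAbs < a.norm.natAbs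
      rw [norm_mul, Int.natAbs_mul, not_lt]
      exact Nat.le_mul_of_pos_right _ (by omega) }

end Zsqrtd

namespace Pell

lemma isFundamental_five_two :
    IsFundamental (Solution₁.mk 5 2 (by norm_num) : Solution₁ 6) := by
  refine ⟨by simp, by simp, fun {b} hb ↦ ?_⟩
  have h := b.prop
  simp only [Solution₁.x_mk]
  by_contra! h₅
  have h₁ : b.y < 2 := by nlinarith
  have h₂ : -2 < b.y := by nlinarith
  generalize b.x = x at *
  generalize b.y = y at *
  interval_cases x <;> interval_cases y <;> omega

end Pell

namespace Zsqrtd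

/-- Modulo cubes, the units of `ℤ√6` are generated by `5 + 2√6`. -/
lemma exists_eq_cube_mul_of_isUnit {u : ℤ√6} (hu : IsUnit u) :
    ∃ v : ℤ√6, u = v ^ 3 ∨ u = v ^ 3 * ⟨5, 2⟩ ∨ u = v ^ 3 * ⟨5, -2⟩ := by
  have hnorm : u.norm = 1 := by
    rcases Int.isUnit_iff.1 ((isUnit_iff_norm_isUnit u).1 hu) with h | h
    · exact h
    · have h₂ : u.re * u.re = 6 * (u.im * u.im) - 1 := by linarith [norm_def u]
      have h₃ : u.re * u.re % 3 = 2 := by omega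
      rcases (by omega : u.re % 3 = 0 ∨ u.re % 3 = 1 ∨ u.re % 3 = 2) with h' | h' | h' <;>
        simp [Int.mul_emod, h'] at h₃
  let s : Pell.Solution₁ 6 := ⟨u, norm_eq_one_iff_mem_unitary.1 hnorm⟩
  set e : Pell.Solution₁ 6 := Pell.Solution₁.mk 5 2 (by norm_num)
  obtain ⟨n, hn⟩ := Pell.isFundamental_five_two.eq_zpow_or_neg_zpow s
  obtain ⟨w, hw⟩ : ∃ w : Pell.Solution₁ 6, s = w ^ 3 * e ^ (n - 3 * ((n + 1) / 3)) := by
    have h : (e ^ ((n + 1) / 3)) ^ 3 * e ^ (n - 3 * ((n + 1) / 3)) = e ^ n := by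
      rw [← zpow_natCast, ← zpow_mul, ← zpow_add]
      congr 1
      push_cast
      ring
    rcases hn with hn | hn
    · exact ⟨_, hn.trans h.symm⟩
    · exact ⟨-e ^ ((n + 1) / 3), by rw [Odd.neg_pow (by decide), neg_mul, h]; exact hn⟩
  refine ⟨w.1, ?_⟩
  have hcoe (t : Pell.Solution₁ 6) (h : s = w ^ 3 * t) : u = w.1 ^ 3 * t.1 :=
    congrArg Subtype.val h
  rcases (by omega : n - 3 * ((n + 1) / 3) = 0 ∨ n - 3 * ((n + 1) / 3) = 1 ∨
    n - 3 * ((n + 1) / 3) = -1) with h | h | h <;> rw [h] at hw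
  · exact .inl ((hcoe 1 (by simpa using hw)).trans (mul_one _))
  · exact .inr (.inl (hcoe e (by simpa using hw)))
  · exact .inr (.inr (hcoe e⁻¹ (by simpa using hw)))

/-- An element of `ℤ√6` with coprime coordinates and cubic norm is a cube up to a unit. -/
lemma exists_eq_cube_mul_of_norm_eq_cube_s7 {p q c : ℤ} (hpq : IsCoprime p q)
    (h : p ^ 2 - 6 * q ^ 2 = c ^ 3) :
    ∃ g : ℤ√6, (⟨p, q⟩ : ℤ√6) = g ^ 3 ∨ (⟨p, q⟩ : ℤ√6) = g ^ 3 * ⟨5, 2⟩ ∨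
      (⟨p, q⟩ : ℤ√6) = g ^ 3 * ⟨5, -2⟩ := by
  have hc : IsCoprime (2 * p) c := by
    have h₂ : ¬ (2 : ℤ) ∣ c := by
      rintro ⟨d, rfl⟩
      obtain ⟨m, rfl⟩ : (2 : ℤ) ∣ p := Int.prime_two.dvd_of_dvd_pow
        (⟨3 * q ^ 2 + 4 * d ^ 3, by linear_combination h⟩ : (2 : ℤ) ∣ p ^ 2)
      obtain ⟨n, rfl⟩ : (2 : ℤ) ∣ q := Int.prime_two.dvd_of_dvd_pow
        (⟨m ^ 2 - q ^ 2 - 2 * d ^ 3, by linarith⟩ : (2 : ℤ) ∣ q ^ 2)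
      exact Int.prime_two.not_isUnit (hpq.isUnit_of_dvd' ⟨m, rfl⟩ ⟨n, rfl⟩)
    have h₃ : ¬ (3 : ℤ) ∣ c := by
      rintro ⟨d, rfl⟩
      obtain ⟨m, rfl⟩ : (3 : ℤ) ∣ p := Int.prime_three.dvd_of_dvd_pow
        (⟨2 * q ^ 2 + 9 * d ^ 3, by linear_combination h⟩ : (3 : ℤ) ∣ p ^ 2)
      obtain ⟨n, rfl⟩ : (3 : ℤ) ∣ q := Int.prime_three.dvd_of_dvd_pow
        (⟨q ^ 2 - m ^ 2 + 3 * d ^ 3, by linarith⟩ : (3 : ℤ) ∣ q ^ 2)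
      exact Int.prime_three.not_isUnit (hpq.isUnit_of_dvd' ⟨m, rfl⟩ ⟨n, rfl⟩)
    have h₂' : IsCoprime 2 c := (Int.prime_two.coprime_iff_not_dvd).2 h₂
    have h₃' : IsCoprime 3 c := (Int.prime_three.coprime_iff_not_dvd).2 h₃
    refine h₂'.mul_left (isCoprime_of_prime_dvd (fun h0 ↦ h₂ (h0.2 ▸ dvd_zero _)) ?_)
    intro l hl hlp hlc
    have h₆ : l ∣ 6 * q ^ 2 := by
      have : 6 * q ^ 2 = p ^ 2 - c ^ 3 := by linarith
      rw [this]
      exact dvd_sub (dvd_pow hlp two_ne_zero) (dvd_pow hlc three_ne_zero)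
    rw [show (6 : ℤ) = 2 * 3 by norm_num] at h₆
    rcases hl.dvd_or_dvd h₆ with h₆ | h₆
    · exact hl.not_isUnit ((h₂'.mul_left h₃').isUnit_of_dvd' h₆ hlc)
    · exact hl.not_isUnit (hpq.isUnit_of_dvd' hlp (hl.dvd_of_dvd_pow h₆))
  have hmul : (⟨p, q⟩ : ℤ√6) * ⟨p, -q⟩ = (c : ℤ√6) ^ 3 := by
    rw [← Int.cast_pow, ← h]
    ext <;> simp only [re_mul, im_mul, re_intCast, im_intCast] <;> ring
  have hcop : IsCoprime (⟨p, q⟩ : ℤ√6) ⟨p, -q⟩ := by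
    obtain ⟨s, t, hst⟩ := hc.pow_right (n := 3)
    refine ⟨s + t * ⟨p, -q⟩, s, ?_⟩
    have hadd : (⟨p, q⟩ : ℤ√6) + ⟨p, -q⟩ = ((2 * p : ℤ) : ℤ√6) := by
      ext <;> simp; ring
    have hst' : (s : ℤ√6) * ((2 * p : ℤ) : ℤ√6) + t * (c : ℤ√6) ^ 3 = 1 := by
      exact_mod_cast congrArg (Int.cast : ℤ → ℤ√6) hst
    rw [← hst', ← hadd, ← hmul]
    ring
  obtain ⟨d, u, hu⟩ := exists_associated_pow_of_mul_eq_pow' hcop hmul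
  obtain ⟨v, hv⟩ := exists_eq_cube_mul_of_isUnit u.isUnit
  refine ⟨d * v, ?_⟩
  rw [← hu]
  rcases hv with hv | hv | hv <;> rw [hv]
  · exact .inl (by ring)
  · exact .inr (.inl (by ring))
  · exact .inr (.inr (by ring))

lemma cube_mk_six (x y : ℤ) :
    (⟨x, y⟩ : ℤ√6) ^ 3 = ⟨x ^ 3 + 18 * x * y ^ 2, 3 * x ^ 2 * y + 6 * y ^ 3⟩ := by
  ext <;> simp [pow_succ] <;> ring

end Zsqrtd

/-- **Lemma, part v)**: every primitive integer solution of `3b² - 2a² = c³` is given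
by one of the two stated parametrizations, up to independent signs. -/
theorem param_three_b_sq_sub_two_a_sq_eq_c_cubed (a b c : ℤ)
    (hgcd : Int.gcd (Int.gcd a b) c = 1) (heq : 3 * b ^ 2 - 2 * a ^ 2 = c ^ 3) :
    ∃ x y ε₁ ε₂ : ℤ, Int.gcd x y = 1 ∧ (ε₁ = 1 ∨ ε₁ = -1) ∧ (ε₂ = 1 ∨ ε₂ = -1) ∧
      ((a = ε₁ * (x ^ 3 + 9 * x ^ 2 * y + 18 * x * y ^ 2 + 18 * y ^ 3) ∧
        b = ε₂ * (x ^ 3 + 6 * x ^ 2 * y + 18 * x * y ^ 2 + 12 * y ^ 3)) ∨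
       (a = ε₁ * (11 * x ^ 3 + 81 * x ^ 2 * y + 198 * x * y ^ 2 + 162 * y ^ 3) ∧
        b = ε₂ * (9 * x ^ 3 + 66 * x ^ 2 * y + 162 * x * y ^ 2 + 132 * y ^ 3))) := by
  have hab : IsCoprime a b := by
    refine isCoprime_of_prime_dvd ?_ fun l hl hla hlb ↦ ?_
    · rintro ⟨rfl, rfl⟩
      have : c = 0 := by simpa using heq.symm
      simp [this] at hgcd
    · have hlc : l ∣ c := hl.dvd_of_dvd_pow (n := 3) <| heq ▸
        dvd_sub ((dvd_pow hlb two_ne_zero).mul_left 3) ((dvd_pow hla two_ne_zero).mul_left 2)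
      have := Int.dvd_coe_gcd (Int.dvd_coe_gcd hla hlb) hlc
      rw [hgcd] at this
      exact hl.not_isUnit (isUnit_of_dvd_one (by simpa using this))
  have hpq : IsCoprime (3 * b - 2 * a) (a - b) := by
    obtain ⟨s, t, hst⟩ := hab
    exact ⟨s + t, 3 * s + 2 * t, by linear_combination hst⟩
  obtain ⟨⟨x, y⟩, hg⟩ := Zsqrtd.exists_eq_cube_mul_of_norm_eq_cube_s7 (c := c) hpq
    (by linear_combination heq)
  rw [Zsqrtd.cube_mk_six] at hg
  simp only [Zsqrtd.ext_iff, Zsqrtd.re_mul, Zsqrtd.im_mul] at hg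
  have hxy : IsCoprime x y := by
    refine isCoprime_of_prime_dvd ?_ fun l hl ⟨m, hm⟩ ⟨n, hn⟩ ↦ ?_
    · rintro ⟨rfl, rfl⟩
      obtain ⟨h₁, h₂⟩ : 3 * b - 2 * a = 0 ∧ a - b = 0 := by simpa using hg
      exact not_isCoprime_zero_zero (h₁ ▸ h₂ ▸ hpq)
    · have h₁ : l ∣ x ^ 3 + 18 * x * y ^ 2 := ⟨m * (x ^ 2 + 18 * y ^ 2), by rw [hm]; ring⟩
      have h₂ : l ∣ 3 * x ^ 2 * y + 6 * y ^ 3 := ⟨n * (3 * x ^ 2 + 6 * y ^ 2), by rw [hn]; ring⟩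
      refine hl.not_isUnit (hpq.isUnit_of_dvd' ?_ ?_) <;>
        rcases hg with hg | hg | hg <;> simp only [hg] <;>
        first
        | assumption
        | exact dvd_add (h₁.mul_right _) (h₂.mul_left _ |>.mul_right _)
        | exact dvd_add (h₁.mul_right _) (h₂.mul_right _)
  rcases hg with ⟨h₁, h₂⟩ | ⟨h₁, h₂⟩ | ⟨h₁, h₂⟩
  · exact ⟨x, y, 1, 1, Int.isCoprime_iff_gcd_eq_one.1 hxy, .inl rfl, .inl rfl,
      .inl ⟨by linear_combination h₁ + 3 * h₂, by linear_combination h₁ + 2 * h₂⟩⟩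
  · exact ⟨x, y, 1, 1, Int.isCoprime_iff_gcd_eq_one.1 hxy, .inl rfl, .inl rfl,
      .inr ⟨by linear_combination h₁ + 3 * h₂, by linear_combination h₁ + 2 * h₂⟩⟩
  · exact ⟨x, -y, -1, 1, Int.isCoprime_iff_gcd_eq_one.1 hxy.neg_right, .inr rfl, .inl rfl,
      .inl ⟨by linear_combination h₁ + 3 * h₂, by linear_combination h₁ + 2 * h₂⟩⟩
end

section
/- Let a, b, c be integers with gcd(a, b, c) = 1 satisfying a² + b² = 2c². Then there exist coprime integers x, y and signs ε₁, ε₂ ∈ {1, -1} (chosen independently) such that a = ε₁(x² - 2xy - y²) and b = ε₂(x² + 2xy - y²). -/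
/-- **Lemma, part vi)**: every primitive integer solution of `a² + b² = 2c²` is given
by the stated parametrization, up to independent signs. -/
theorem param_a_sq_add_b_sq_eq_two_c_sq (a b c : ℤ)
    (hgcd : Int.gcd (Int.gcd a b) c = 1) (heq : a ^ 2 + b ^ 2 = 2 * c ^ 2) :
    ∃ x y ε₁ ε₂ : ℤ, Int.gcd x y = 1 ∧ (ε₁ = 1 ∨ ε₁ = -1) ∧ (ε₂ = 1 ∨ ε₂ = -1) ∧
      a = ε₁ * (x ^ 2 - 2 * x * y - y ^ 2) ∧
      b = ε₂ * (x ^ 2 + 2 * x * y - y ^ 2) := by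
  have hpar : Even (a + b) := by
    have h : Even (a ^ 2 + b ^ 2) := heq ▸ even_two_mul _
    simpa [Int.even_add, Int.even_pow] using h
  obtain ⟨u, hu⟩ := hpar
  obtain ⟨v, rfl⟩ : ∃ v, b = u + v := ⟨b - u, by ring⟩
  obtain rfl : a = u - v := by linarith
  have hpyth : PythagoreanTriple u v c := by
    unfold PythagoreanTriple
    linarith
  have hcop : Int.gcd u v = 1 := by
    have hdu : (Int.gcd u v : ℤ) ∣ u := Int.gcd_dvd_left ..
    have hdv : (Int.gcd u v : ℤ) ∣ v := Int.gcd_dvd_right ..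
    have h := Int.dvd_coe_gcd (Int.dvd_coe_gcd (dvd_sub hdu hdv) (dvd_add hdu hdv)) hpyth.gcd_dvd
    rw [hgcd] at h
    exact Nat.dvd_one.mp (by exact_mod_cast h)
  obtain ⟨m, n, h, -, hmn, -⟩ := PythagoreanTriple.coprime_classification.mp ⟨hpyth, hcop⟩
  rcases h with ⟨rfl, rfl⟩ | ⟨rfl, rfl⟩
  · exact ⟨m, n, 1, 1, hmn, Or.inl rfl, Or.inl rfl, by ring, by ring⟩
  · exact ⟨m, n, -1, 1, hmn, Or.inr rfl, Or.inl rfl, by ring, by ring⟩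
end

section
/- Let a, b, c be integers with gcd(a, b, c) = 1 satisfying 2a² + b² = 3c². Then there exist coprime integers x, y and signs ε₁, ε₂ ∈ {1, -1} (chosen independently) such that a = ε₁(x² + 2xy - 2y²) and b = ε₂(x² - 4xy - 2y²). -/
/-- Parametrization of `u² + 2v² = c²` when `c - u` is divisible by `4`. -/
theorem exists_param_sq_add_two_mul_sq_of_dvd {u v c : ℤ} (hc : 0 < c)
    (h : u ^ 2 + 2 * v ^ 2 = c ^ 2) (hp : ∀ d : ℤ, d ∣ u → d ∣ v → d ∣ c → IsUnit d)
    (hu : ¬ 2 ∣ u) (h4 : 4 ∣ c - u) :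
    ∃ x y : ℤ, Int.gcd x y = 1 ∧ u = x ^ 2 - 2 * y ^ 2 ∧ v = 2 * x * y := by
  obtain ⟨k, hk⟩ := h4
  obtain ⟨m, rfl⟩ : ∃ m, u = m - 2 * k := ⟨u + 2 * k, by ring⟩
  obtain rfl : c = m + 2 * k := by linarith
  have hv : v ^ 2 = 4 * (m * k) := by linarith
  obtain ⟨w, rfl⟩ : (2 : ℤ) ∣ v :=
    Int.prime_two.dvd_of_dvd_pow (n := 2) ⟨2 * (m * k), by linarith⟩
  have hmk : m * k = w ^ 2 := by linarith
  have hcop : Int.gcd m k = 1 := by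
    have hm := Int.gcd_dvd_left m k
    have hk := Int.gcd_dvd_right m k
    have hw : (Int.gcd m k : ℤ) ∣ w := by
      rw [← Int.pow_dvd_pow_iff two_ne_zero, ← hmk, sq]
      exact mul_dvd_mul hm hk
    simpa [Int.isUnit_iff_natAbs_eq] using hp _ (dvd_sub hm (hk.mul_left 2))
      (hw.mul_left 2) (dvd_add hm (hk.mul_left 2))
  have hm0 : 0 ≤ m := by
    by_contra! hm
    nlinarith [sq_nonneg w]
  have hk0 : 0 ≤ k := by
    by_contra! hk
    nlinarith [sq_nonneg w]
  obtain ⟨x, hx⟩ : ∃ x, m = x ^ 2 := by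
    obtain ⟨x, hx | hx⟩ := Int.sq_of_gcd_eq_one hcop hmk
    · exact ⟨x, hx⟩
    · exact ⟨0, by nlinarith [sq_nonneg x]⟩
  obtain ⟨y, hy⟩ : ∃ y, k = y ^ 2 := by
    obtain ⟨y, hy | hy⟩ := Int.sq_of_gcd_eq_one (Int.gcd_comm m k ▸ hcop) (mul_comm m k ▸ hmk)
    · exact ⟨y, hy⟩
    · exact ⟨0, by nlinarith [sq_nonneg y]⟩
  subst hx hy
  have hxy : IsCoprime x y := by
    rw [← Int.isCoprime_iff_gcd_eq_one] at hcop
    exact (IsCoprime.pow_iff two_pos two_pos).1 hcop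
  have hw : w ^ 2 = (x * y) ^ 2 := by rw [← hmk]; ring
  rcases sq_eq_sq_iff_eq_or_eq_neg.1 hw with rfl | rfl
  · exact ⟨x, y, Int.isCoprime_iff_gcd_eq_one.1 hxy, rfl, by ring⟩
  · exact ⟨x, -y, Int.isCoprime_iff_gcd_eq_one.1 hxy.neg_right, by ring, by ring⟩

/-- Parametrization of the primitive solutions of `u² + 2v² = c²`. -/
theorem exists_param_sq_add_two_mul_sq {u v c : ℤ} (hc : 0 < c)
    (h : u ^ 2 + 2 * v ^ 2 = c ^ 2) (hp : ∀ d : ℤ, d ∣ u → d ∣ v → d ∣ c → IsUnit d) :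
    ∃ x y ε : ℤ, Int.gcd x y = 1 ∧ (ε = 1 ∨ ε = -1) ∧
      u = ε * (x ^ 2 - 2 * y ^ 2) ∧ v = ε * (2 * x * y) := by
  have hu : ¬ 2 ∣ u := by
    rintro ⟨s, rfl⟩
    obtain ⟨t, rfl⟩ : (2 : ℤ) ∣ c :=
      Int.prime_two.dvd_of_dvd_pow (n := 2) ⟨2 * s ^ 2 + v ^ 2, by linarith⟩
    obtain ⟨r, rfl⟩ : (2 : ℤ) ∣ v :=
      Int.prime_two.dvd_of_dvd_pow (n := 2) ⟨t ^ 2 - s ^ 2, by linarith⟩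
    exact Int.prime_two.not_isUnit (hp 2 ⟨s, rfl⟩ ⟨r, rfl⟩ ⟨t, rfl⟩)
  have hc2 : ¬ 2 ∣ c := by
    rintro ⟨t, rfl⟩
    exact hu (Int.prime_two.dvd_of_dvd_pow (n := 2) ⟨2 * t ^ 2 - v ^ 2, by linarith⟩)
  have h4 : 4 ∣ c - u ∨ 4 ∣ c - -u := by omega
  rcases h4 with h4 | h4
  · obtain ⟨x, y, hxy, h1, h2⟩ := exists_param_sq_add_two_mul_sq_of_dvd hc h hp hu h4
    exact ⟨x, y, 1, hxy, .inl rfl, by simpa using h1, by simpa using h2⟩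
  · obtain ⟨x, y, hxy, h1, h2⟩ := exists_param_sq_add_two_mul_sq_of_dvd (u := -u) (v := -v) hc
      (by simpa using h) (by simpa using hp) (by simpa using hu) h4
    exact ⟨x, y, -1, hxy, .inr rfl, by linarith, by linarith⟩

/-- The parametrization of `2a² + b² = 3c²` when `c` is positive and `a ≡ b` modulo `3`. -/
theorem exists_param_two_mul_sq_add_sq_of_dvd {a b c : ℤ} (hc : 0 < c)
    (h : 2 * a ^ 2 + b ^ 2 = 3 * c ^ 2)
    (hp : ∀ d : ℤ, d ∣ a → d ∣ b → d ∣ c → IsUnit d) (h3 : 3 ∣ a - b) :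
    ∃ x y ε : ℤ, Int.gcd x y = 1 ∧ (ε = 1 ∨ ε = -1) ∧
      a = ε * (x ^ 2 + 2 * x * y - 2 * y ^ 2) ∧ b = ε * (x ^ 2 - 4 * x * y - 2 * y ^ 2) := by
  obtain ⟨v, hv⟩ := h3
  obtain ⟨u, rfl⟩ : ∃ u, a = u + v := ⟨a - v, by ring⟩
  obtain rfl : b = u - 2 * v := by linarith
  obtain ⟨x, y, ε, hxy, hε, rfl, rfl⟩ := exists_param_sq_add_two_mul_sq (u := u) (v := v) hc
    (by linarith) fun d hu hv ↦ hp d (dvd_add hu hv) (dvd_sub hu (hv.mul_left 2))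
  exact ⟨x, y, ε, hxy, hε, by ring, by ring⟩

/-- **Lemma, part vii)**: every primitive integer solution of `2a² + b² = 3c²` is given
by the stated parametrization, up to independent signs. -/
theorem param_two_a_sq_add_b_sq_eq_three_c_sq (a b c : ℤ)
    (hgcd : Int.gcd (Int.gcd a b) c = 1) (heq : 2 * a ^ 2 + b ^ 2 = 3 * c ^ 2) :
    ∃ x y ε₁ ε₂ : ℤ, Int.gcd x y = 1 ∧ (ε₁ = 1 ∨ ε₁ = -1) ∧ (ε₂ = 1 ∨ ε₂ = -1) ∧
      a = ε₁ * (x ^ 2 + 2 * x * y - 2 * y ^ 2) ∧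
      b = ε₂ * (x ^ 2 - 4 * x * y - 2 * y ^ 2) := by
  have hp : ∀ d : ℤ, d ∣ a → d ∣ b → d ∣ |c| → IsUnit d := fun d ha hb hc ↦ by
    have hd := Int.dvd_coe_gcd (Int.dvd_coe_gcd ha hb) ((dvd_abs d c).1 hc)
    rw [hgcd] at hd
    exact isUnit_of_dvd_one (by simpa using hd)
  have hc : 0 < |c| := by
    rw [abs_pos]
    rintro rfl
    have ha : a = 0 := by nlinarith [sq_nonneg a, sq_nonneg b]
    have hb : b = 0 := by nlinarith [sq_nonneg a, sq_nonneg b]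
    simp [ha, hb] at hgcd
  have h3 : 3 ∣ a - b ∨ 3 ∣ a - -b :=
    Int.prime_three.dvd_or_dvd ⟨a ^ 2 - c ^ 2, by linarith⟩
  rcases h3 with h3 | h3
  · obtain ⟨x, y, ε, hxy, hε, ha, hb⟩ := exists_param_two_mul_sq_add_sq_of_dvd hc
      (by rwa [sq_abs]) hp h3
    exact ⟨x, y, ε, ε, hxy, hε, hε, ha, hb⟩
  · obtain ⟨x, y, ε, hxy, hε, ha, hb⟩ := exists_param_two_mul_sq_add_sq_of_dvd (b := -b) hc
      (by rwa [sq_abs, neg_sq]) (by simpa using hp) h3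
    exact ⟨x, y, ε, -ε, hxy, hε, by omega, ha, by linarith⟩
end

section
/- There are no rational numbers X, Y satisfying Y² = -4X³ + 60X² + 15X + 2. (The elliptic curve described by this equation has no affine rational points.) -/
namespace Zsqrtd

variable {d : ℤ}

theorem exists_norm_sub_mul_lt_s12 (hd : ∀ n : ℤ, d ≠ n * n)
    (hE : ∀ x y : ℚ, ∃ m n : ℤ, |(x - m) ^ 2 - d * (y - n) ^ 2| < 1) (a : ℤ√d) {b : ℤ√d}
    (hb : b ≠ 0) : ∃ q : ℤ√d, (a - b * q).norm.natAbs < b.norm.natAbs := by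
  have hN : (b.norm : ℚ) ≠ 0 := by
    exact_mod_cast fun h => hb ((norm_eq_zero hd b).1 h)
  obtain ⟨m, n, h⟩ := hE ((a * star b).re / b.norm) ((a * star b).im / b.norm)
  refine ⟨⟨m, n⟩, ?_⟩
  have key : ((a - b * ⟨m, n⟩).norm : ℚ) = b.norm *
      (((a * star b).re / b.norm - m) ^ 2 - d * ((a * star b).im / b.norm - n) ^ 2) := by
    field_simp
    norm_cast
    simp only [norm_def, re_sub, re_mul, im_sub, im_mul, re_star, im_star]
    ring
  zify
  rify at h key ⊢
  rw [key, abs_mul]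
  have : 0 < |(b.norm : ℝ)| := by
    rw [abs_pos]; exact_mod_cast hN
  nlinarith

/-- Euclidean division in `ℤ√d` with respect to the absolute value of the norm. -/
noncomputable abbrev euclideanDomain (hd : ∀ n : ℤ, d ≠ n * n)
    (hE : ∀ x y : ℚ, ∃ m n : ℤ, |(x - m) ^ 2 - d * (y - n) ^ 2| < 1) :
    EuclideanDomain (ℤ√d) :=
  open Classical in
  { (inferInstance : CommRing (ℤ√d)), (inferInstance : Nontrivial (ℤ√d)) with
    quotient := fun a b =>
      if hb : b = 0 then 0 else (exists_norm_sub_mul_lt_s12 hd hE a hb).choose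
    remainder := fun a b =>
      a - b * if hb : b = 0 then 0 else (exists_norm_sub_mul_lt_s12 hd hE a hb).choose
    quotient_zero := fun a => dif_pos rfl
    quotient_mul_add_remainder_eq := fun a b => by ring
    r := fun a b => a.norm.natAbs < b.norm.natAbs
    r_wellFounded := (measure fun a : ℤ√d => a.norm.natAbs).wf
    remainder_lt := fun a b hb => by
      simp only [dif_neg hb]
      exact (exists_norm_sub_mul_lt_s12 hd hE a hb).choose_spec
    mul_left_not_lt := fun a b hb => by
      rw [not_lt, norm_mul, Int.natAbs_mul]
      exact Nat.le_mul_of_pos_right _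
        (Int.natAbs_pos.2 fun h => hb ((norm_eq_zero hd b).1 h)) }

theorem exists_isUnit_mul_cube (hd : ∀ n : ℤ, d ≠ n * n)
    (hE : ∀ x y : ℚ, ∃ m n : ℤ, |(x - m) ^ 2 - d * (y - n) ^ 2| < 1) {x y c : ℤ}
    (h : x ^ 2 - d * y ^ 2 = c ^ 3) (hxy : IsCoprime x y) (hc : IsCoprime c (2 * d)) :
    ∃ u g : ℤ√d, IsUnit u ∧ (⟨x, y⟩ : ℤ√d) = u * g ^ 3 := by
  have hprod : (⟨x, y⟩ : ℤ√d) * ⟨x, -y⟩ = (c : ℤ√d) ^ 3 := by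
    rw [← Int.cast_pow, ← h]
    ext <;> simp [pow_two] <;> ring
  have hcop : IsCoprime (⟨x, y⟩ : ℤ√d) ⟨x, -y⟩ := by
    obtain ⟨a, b, hab⟩ := hxy
    obtain ⟨g, k, hgk⟩ := hc.pow_left (m := 3)
    refine ⟨g * ⟨x, -y⟩ + k * ⟨d * a, b⟩, k * ⟨d * a, -b⟩, ?_⟩
    rw [← h] at hgk
    ext
    · simp
      linear_combination hgk + 2 * d * k * hab
    · simp
      ring
  let := euclideanDomain hd hE
  obtain ⟨g, u, hu⟩ := exists_associated_pow_of_mul_eq_pow' hcop hprod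
  exact ⟨u, g, u.isUnit, by rw [← hu, mul_comm]⟩

end Zsqrtd

theorem abs_sub_round_sq (x : ℚ) : (x - round x) ^ 2 ≤ 1 / 4 := by
  have := abs_le.1 (abs_sub_round x)
  nlinarith

theorem exists_abs_norm_neg_two_lt_one (x y : ℚ) :
    ∃ m n : ℤ, |(x - m) ^ 2 - (-2 : ℤ) * (y - n) ^ 2| < 1 := by
  refine ⟨round x, round y, ?_⟩
  have := abs_sub_round_sq x
  have := abs_sub_round_sq y
  push_cast
  rw [abs_lt]
  constructor <;> nlinarith [sq_nonneg (x - round x), sq_nonneg (y - round y)]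

theorem ne_five_twentyfourths_sq (y : ℚ) : y ^ 2 ≠ 5 / 24 := by
  intro h
  have h1 : IsSquare ((30 : ℕ) : ℚ) := ⟨12 * y, by push_cast; linarith⟩
  rw [Rat.isSquare_natCast_iff] at h1
  revert h1
  decide +kernel

theorem exists_abs_norm_six_lt_one (x y : ℚ) :
    ∃ m n : ℤ, |(x - m) ^ 2 - (6 : ℤ) * (y - n) ^ 2| < 1 := by
  have hy := abs_sub_round_sq y
  have hx := abs_sub_round_sq x
  have hxa := abs_le.1 (abs_sub_round x)
  have h5 := ne_five_twentyfourths_sq (y - round y)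
  obtain ⟨σ, hσ, h0, hsq⟩ : ∃ σ : ℤ, σ ^ 2 = 1 ∧ 0 ≤ σ * (x - round x) ∧
      σ * (x - round x) ≤ 1 / 2 := by
    rcases le_total 0 (x - round x) with h | h
    · exact ⟨1, by norm_num, by simpa using h, by push_cast; linarith⟩
    · exact ⟨-1, by norm_num, by push_cast; linarith, by push_cast; linarith⟩
  have hσ' : (σ : ℚ) ^ 2 = 1 := by exact_mod_cast hσ
  set z : ℚ := y - round y with hz
  set w : ℚ := σ * (x - round x) with hw
  have hwx (k : ℤ) : (x - (round x + σ * k : ℤ)) ^ 2 = (w - k) ^ 2 := by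
    push_cast
    rw [hw]
    linear_combination (k ^ 2 - (x - round x) ^ 2) * hσ'
  have H (k : ℤ) (hk : |(w - k) ^ 2 - 6 * z ^ 2| < 1) :
      ∃ m n : ℤ, |(x - m) ^ 2 - (6 : ℤ) * (y - n) ^ 2| < 1 :=
    ⟨round x + σ * k, round y, by rw [hwx, ← hz]; exact_mod_cast hk⟩
  by_cases h1 : 6 * z ^ 2 < 1
  · exact H 0 (by push_cast; rw [abs_lt]; constructor <;> nlinarith)
  by_cases h2 : 6 * z ^ 2 - 1 < (w - 1) ^ 2
  · exact H 1 (by push_cast; rw [abs_lt]; constructor <;> nlinarith)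
  · refine H (-1) ?_
    push_cast
    rw [abs_lt]
    refine ⟨by nlinarith, ?_⟩
    rcases hsq.lt_or_eq with h | h
    · nlinarith
    · rw [h] at h2 ⊢
      have : z ^ 2 ≠ 5 / 24 := h5
      rcases lt_or_gt_of_ne this with h | h <;> linarith

theorem isCoprime_of_sq_sub_mul_sq_eq_cube {d x y c : ℤ} (h : x ^ 2 - d * y ^ 2 = c ^ 3)
    (hxy : ∀ r : ℤ, Prime r → r ∣ x → r ∣ y → r ∣ 2) (hc : Odd c) : IsCoprime x y := by
  refine isCoprime_of_prime_dvd ?_ fun r hr hx hy => ?_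
  · rintro ⟨rfl, rfl⟩
    have := hxy 3 Int.prime_three (dvd_zero _) (dvd_zero _)
    omega
  · have h2 := hxy r hr hx hy
    have hrc : r ∣ c := hr.dvd_of_dvd_pow (n := 3) <| h ▸
      dvd_sub (dvd_pow hx two_ne_zero) (dvd_mul_of_dvd_right (dvd_pow hy two_ne_zero) _)
    obtain ⟨k, rfl⟩ := hc
    have : r ∣ 1 := by
      simpa using dvd_sub hrc (dvd_mul_of_dvd_left h2 k)
    exact hr.not_isUnit (isUnit_of_dvd_one this)

theorem exists_isUnit_mul_cube_neg_two (n : ℕ) {x y c : ℤ} (hn : c.natAbs ≤ n)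
    (h : x ^ 2 - (-2) * y ^ 2 = c ^ 3)
    (hxy : ∀ r : ℤ, Prime r → r ∣ x → r ∣ y → r ∣ 2) :
    ∃ u g : ℤ√(-2), IsUnit u ∧ (⟨x, y⟩ : ℤ√(-2)) = u * g ^ 3 := by
  induction n generalizing x y c with
  | zero =>
    obtain rfl : c = 0 := by omega
    obtain rfl : x = 0 := by nlinarith [sq_nonneg x, sq_nonneg y]
    obtain rfl : y = 0 := by nlinarith [sq_nonneg y]
    exact ⟨1, 0, isUnit_one, by ext <;> simp⟩
  | succ n ih =>
    rcases Int.even_or_odd c with ⟨c, rfl⟩ | hc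
    · obtain ⟨x, rfl⟩ : 2 ∣ x := Int.prime_two.dvd_of_dvd_pow (n := 2)
        ⟨4 * c ^ 3 - y ^ 2, by linear_combination h⟩
      obtain ⟨y, rfl⟩ : 2 ∣ y := Int.prime_two.dvd_of_dvd_pow (n := 2)
        ⟨2 * c ^ 3 - x ^ 2, by linarith⟩
      obtain ⟨x, rfl⟩ : 2 ∣ x := Int.prime_two.dvd_of_dvd_pow (n := 2)
        ⟨c ^ 3 - y ^ 2, by linarith⟩
      have hc0 : c ≠ 0 := by
        rintro rfl
        have hx : x = 0 := by nlinarith [sq_nonneg x, sq_nonneg y]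
        have hy : y = 0 := by nlinarith [sq_nonneg x, sq_nonneg y]
        have := hxy 3 Int.prime_three (by simp [hx]) (by simp [hy])
        omega
      obtain ⟨u, g, hu, hg⟩ := ih (x := y) (y := -x) (c := c) (by omega) (by linarith)
        fun r hr h1 h2 => hxy r hr (dvd_mul_of_dvd_right (dvd_mul_of_dvd_right
          ((dvd_neg.1 h2)) _) _) (dvd_mul_of_dvd_right h1 _)
      refine ⟨u, ⟨0, -1⟩ * g, hu, ?_⟩
      rw [mul_pow, mul_left_comm u, ← hg]
      ext <;> simp [pow_succ]; ring
    · refine Zsqrtd.exists_isUnit_mul_cube ?_ exists_abs_norm_neg_two_lt_one h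
        (isCoprime_of_sq_sub_mul_sq_eq_cube h hxy hc) ?_
      · intro n
        nlinarith [mul_self_nonneg n]
      · have h2 : IsCoprime c 2 := by simpa using hc
        exact h2.mul_right h2.neg_right

/-- If `x² + 2y²` is a cube and no odd prime divides both `x` and `y`, then `x + y√-2` is a cube
in `ℤ[√-2]`. -/
theorem exists_eq_cube_of_sq_add_two_mul_sq_eq_cube {x y c : ℤ}
    (h : x ^ 2 + 2 * y ^ 2 = c ^ 3) (hxy : ∀ r : ℤ, Prime r → r ∣ x → r ∣ y → r ∣ 2) :
    ∃ a b : ℤ, x = a ^ 3 - 6 * a * b ^ 2 ∧ y = 3 * a ^ 2 * b - 2 * b ^ 3 ∧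
      c = a ^ 2 + 2 * b ^ 2 := by
  suffices ∃ a b : ℤ, x = a ^ 3 - 6 * a * b ^ 2 ∧ y = 3 * a ^ 2 * b - 2 * b ^ 3 by
    obtain ⟨a, b, hx, hy⟩ := this
    refine ⟨a, b, hx, hy, (Odd.strictMono_pow (n := 3) (by decide)).injective ?_⟩
    rw [← h, hx, hy]
    ring
  obtain ⟨u, ⟨a, b⟩, hu, hg⟩ := exists_isUnit_mul_cube_neg_two c.natAbs le_rfl
    (by linarith) hxy
  rw [← Zsqrtd.norm_eq_one_iff' (by norm_num), Zsqrtd.norm_def] at hu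
  obtain ⟨v, w⟩ := u
  have hw : w = 0 := by
    simp only at hu
    nlinarith [mul_self_nonneg v, mul_self_nonneg w]
  subst hw
  have hv : v = 1 ∨ v = -1 := by
    rw [← sq_eq_one_iff]
    simp at hu
    linarith
  rw [Zsqrtd.ext_iff] at hg
  simp [pow_succ] at hg
  rcases hv with rfl | rfl
  · exact ⟨a, b, by linarith, by linarith⟩
  · exact ⟨-a, -b, by linarith, by linarith⟩

theorem exists_isUnit_mul_cube_six (n : ℕ) {x y c : ℤ} (hn : c.natAbs ≤ n)
    (h : x ^ 2 - 6 * y ^ 2 = c ^ 3) (h3 : ¬ 3 ∣ c)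
    (hxy : ∀ r : ℤ, Prime r → r ∣ x → r ∣ y → r ∣ 2) :
    ∃ u g : ℤ√6, IsUnit u ∧ (⟨x, y⟩ : ℤ√6) = u * g ^ 3 := by
  induction n generalizing x y c with
  | zero =>
    obtain rfl : c = 0 := by omega
    simp at h3
  | succ n ih =>
    rcases Int.even_or_odd c with ⟨c, rfl⟩ | hc
    · obtain ⟨x, rfl⟩ : 2 ∣ x := Int.prime_two.dvd_of_dvd_pow (n := 2)
        ⟨4 * c ^ 3 + 3 * y ^ 2, by linear_combination h⟩
      obtain ⟨y, rfl⟩ : 2 ∣ y := Int.prime_two.dvd_of_dvd_pow (n := 2)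
        ⟨x ^ 2 - y ^ 2 - 2 * c ^ 3, by linarith⟩
      obtain ⟨x, rfl⟩ : 2 ∣ x := Int.prime_two.dvd_of_dvd_pow (n := 2)
        ⟨c ^ 3 + 3 * y ^ 2, by linarith⟩
      have hc0 : c ≠ 0 := by
        rintro rfl
        simp at h3
      have hdvd (r : ℤ) (h1 : r ∣ 3 * y - 2 * x) (h2 : r ∣ x - y) : r ∣ x ∧ r ∣ y := by
        have hy : r ∣ y := by
          have := dvd_add h1 (dvd_mul_of_dvd_right h2 2)
          rwa [show 3 * y - 2 * x + 2 * (x - y) = y by ring] at this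
        exact ⟨by simpa using dvd_add h2 hy, hy⟩
      obtain ⟨u, g, hu, hg⟩ := ih (x := 3 * y - 2 * x) (y := x - y) (c := -c) (by omega)
        (by linarith) (by omega) fun r hr h1 h2 => hxy r hr
          (dvd_mul_of_dvd_right (dvd_mul_of_dvd_right (hdvd r h1 h2).1 _) _)
          (dvd_mul_of_dvd_right (hdvd r h1 h2).2 _)
      refine ⟨⟨5, -2⟩ * u, ⟨2, 1⟩ * g, .mul ?_ hu, ?_⟩
      · rw [← Zsqrtd.norm_eq_one_iff, Zsqrtd.norm_def]
        norm_num
      · rw [mul_pow, mul_mul_mul_comm, ← hg]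
        ext <;> simp [pow_succ] <;> ring
    · refine Zsqrtd.exists_isUnit_mul_cube ?_ exists_abs_norm_six_lt_one h
        (isCoprime_of_sq_sub_mul_sq_eq_cube h hxy hc) ?_
      · intro n hn
        have : n ≤ 2 := by nlinarith
        have : -2 ≤ n := by nlinarith
        interval_cases n <;> omega
      · have h2 : IsCoprime c 2 := by simpa using hc
        have h3 : IsCoprime c 3 := ((Int.prime_three.coprime_iff_not_dvd).2 h3).symm
        exact (h2.mul_right h2).mul_right h3

theorem isFundamental_five_two :
    Pell.IsFundamental (Pell.Solution₁.mk 5 2 (by norm_num) : Pell.Solution₁ 6) := by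
  refine ⟨by simp, by simp, fun {a} ha => ?_⟩
  rw [Pell.Solution₁.x_mk]
  by_contra! hlt
  have h := a.prop
  generalize a.x = x at *
  generalize a.y = y at *
  have : y ≤ 2 := by nlinarith
  have : -2 ≤ y := by nlinarith
  interval_cases x <;> interval_cases y <;> omega

theorem exists_eq_mul_cube_of_isUnit_six {u : ℤ√6} (hu : IsUnit u) :
    ∃ (v : ℤ) (e g : ℤ√6), e = ⟨1 + v ^ 2, v⟩ ∧ (v = 0 ∨ v = 2 ∨ v = -2) ∧ u = e * g ^ 3 := by
  have hN : u.re ^ 2 - 6 * u.im ^ 2 = 1 := by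
    rw [← Zsqrtd.norm_eq_one_iff, Int.natAbs_eq_iff, Zsqrtd.norm_def] at hu
    rcases hu with h | h
    · push_cast at h; linarith
    · exfalso
      have : u.re * u.re % 3 = 0 ∨ u.re * u.re % 3 = 1 := by
        have : u.re % 3 = 0 ∨ u.re % 3 = 1 ∨ u.re % 3 = 2 := by omega
        rcases this with h | h | h <;> simp [Int.mul_emod, h]
      push_cast at h
      rw [mul_assoc] at h
      omega
  obtain ⟨n, hn⟩ := isFundamental_five_two.eq_zpow_or_neg_zpow (Pell.Solution₁.mk _ _ hN)
  obtain ⟨m, r, hr, rfl⟩ : ∃ m r : ℤ, (r = 0 ∨ r = 1 ∨ r = -1) ∧ n = r + m * 3 :=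
    ⟨(n + 1) / 3, n - (n + 1) / 3 * 3, by omega, by ring⟩
  rw [zpow_add, zpow_mul, zpow_ofNat] at hn
  set f : Pell.Solution₁ 6 := Pell.Solution₁.mk 5 2 (by norm_num) with hf
  set b := f ^ m
  obtain ⟨v, hv, hfv⟩ : ∃ v : ℤ, (v = 0 ∨ v = 2 ∨ v = -2) ∧
      ((f ^ r).x = 1 + v ^ 2 ∧ (f ^ r).y = v) := by
    rcases hr with rfl | rfl | rfl
    · exact ⟨0, by simp⟩
    · exact ⟨2, by simp [hf]⟩
    · exact ⟨-2, by simp [hf]⟩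
  rcases hn with hn | hn
  · refine ⟨v, _, ⟨b.x, b.y⟩, rfl, hv, ?_⟩
    have h1 := congrArg Pell.Solution₁.x hn
    have h2 := congrArg Pell.Solution₁.y hn
    simp [pow_succ, hfv] at h1 h2
    ext <;> simp [pow_succ, h1, h2] <;> ring
  · refine ⟨v, _, ⟨-b.x, -b.y⟩, rfl, hv, ?_⟩
    have h1 := congrArg Pell.Solution₁.x hn
    have h2 := congrArg Pell.Solution₁.y hn
    simp [pow_succ, hfv] at h1 h2
    ext <;> simp [pow_succ, h1, h2] <;> ring

/-- If `x² - 6y²` is the cube of an integer prime to `3` and no odd prime divides both `x` and `y`,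
then `x + y√6` is one of `1`, `5 + 2√6`, `5 - 2√6` times a cube in `ℤ[√6]`. -/
theorem exists_eq_cube_of_sq_sub_six_mul_sq_eq_cube {x y c : ℤ}
    (h : x ^ 2 - 6 * y ^ 2 = c ^ 3) (h3 : ¬ 3 ∣ c)
    (hxy : ∀ r : ℤ, Prime r → r ∣ x → r ∣ y → r ∣ 2) :
    ∃ v p q : ℤ, (v = 0 ∨ v = 2 ∨ v = -2) ∧
      y = (1 + v ^ 2) * (3 * p ^ 2 * q + 6 * q ^ 3) + v * (p ^ 3 + 18 * p * q ^ 2) ∧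
      c = p ^ 2 - 6 * q ^ 2 := by
  obtain ⟨u, g, hu, hg⟩ := exists_isUnit_mul_cube_six c.natAbs le_rfl h h3 hxy
  obtain ⟨v, e, g', rfl, hv, rfl⟩ := exists_eq_mul_cube_of_isUnit_six hu
  rw [mul_assoc, ← mul_pow] at hg
  generalize g' * g = k at hg
  obtain ⟨p, q⟩ := k
  rw [Zsqrtd.ext_iff] at hg
  simp [pow_succ] at hg
  refine ⟨v, p, q, hv, by rw [hg.2]; ring, (Odd.strictMono_pow (n := 3) (by decide)).injective ?_⟩
  rw [← h, hg.1, hg.2]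
  rcases hv with rfl | rfl | rfl <;> ring

theorem three_dvd_of_unit_twist {p q e : ℤ}
    (h : 15 * p ^ 2 * q + 30 * q ^ 3 + 2 * p ^ 3 + 36 * p * q ^ 2 =
      e * (3 * (p ^ 2 - 6 * q ^ 2) - 8 * e ^ 2)) : 3 ∣ p := by
  have key : ∀ p q e : ZMod 9, 15 * p ^ 2 * q + 30 * q ^ 3 + 2 * p ^ 3 + 36 * p * q ^ 2 =
      e * (3 * (p ^ 2 - 6 * q ^ 2) - 8 * e ^ 2) → 3 * p = 0 := by
    decide +kernel
  have h9 := key p q e (by exact_mod_cast congrArg (Int.cast : ℤ → ZMod 9) h)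
  have : (9 : ℤ) ∣ 3 * p := (ZMod.intCast_zmod_eq_zero_iff_dvd _ 9).1 (by exact_mod_cast h9)
  omega

theorem three_dvd_of_norm_nine_twist {a b w : ℤ}
    (h : 2 * (2 * a ^ 3 - 3 * a ^ 2 * b - 12 * a * b ^ 2 + 2 * b ^ 3) =
      9 * w * (a ^ 2 + 2 * b ^ 2) - 8 * w ^ 3) : 3 ∣ a ∧ 3 ∣ b := by
  have key : ∀ a b w : ZMod 9, 2 * (2 * a ^ 3 - 3 * a ^ 2 * b - 12 * a * b ^ 2 + 2 * b ^ 3) =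
      9 * w * (a ^ 2 + 2 * b ^ 2) - 8 * w ^ 3 → 3 * (a + b) = 0 ∧ 3 * w = 0 := by
    decide +kernel
  obtain ⟨h1, h2⟩ := key a b w (by exact_mod_cast congrArg (Int.cast : ℤ → ZMod 9) h)
  have h1 : (9 : ℤ) ∣ 3 * (a + b) :=
    (ZMod.intCast_zmod_eq_zero_iff_dvd _ 9).1 (by exact_mod_cast h1)
  have h2 : (9 : ℤ) ∣ 3 * w := (ZMod.intCast_zmod_eq_zero_iff_dvd _ 9).1 (by exact_mod_cast h2)
  obtain ⟨w, rfl⟩ : 3 ∣ w := by omega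
  obtain ⟨c, hc⟩ : 3 ∣ a + b := by omega
  obtain rfl : b = 3 * c - a := by linarith
  have ha : 3 ∣ a := by
    refine Int.prime_three.dvd_of_dvd_pow (n := 3) ?_
    ring_nf at h
    omega
  omega

theorem two_pow_mul_odd_injective {a b : ℕ} {x y : ℤ} (hx : ¬ 2 ∣ x) (hy : ¬ 2 ∣ y)
    (h : 2 ^ a * x = 2 ^ b * y) : a = b ∧ x = y := by
  induction a generalizing b with
  | zero =>
    cases b with
    | zero => simpa using h
    | succ b => exact absurd ⟨2 ^ b * y, by rw [← mul_assoc, ← pow_succ']; simpa using h⟩ hx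
  | succ a ih =>
    cases b with
    | zero => exact absurd ⟨2 ^ a * x, by rw [← mul_assoc, ← pow_succ']; simpa using h.symm⟩ hy
    | succ b =>
      obtain ⟨rfl, rfl⟩ := ih (b := b) (by rw [pow_succ', pow_succ'] at h; linarith)
      simp

theorem exists_cubes_of_mul_eq {t N f : ℤ} (h : t * N = 288 * f ^ 3) (hf : f ≠ 0)
    (hcop : ∀ r : ℤ, Prime r → r ∣ t → r ∣ N → r ∣ 2) :
    ∃ (k : ℕ) (z w : ℤ), 2 * 2 ^ k * f = w * z ∧
      (4 ^ k * N = z ^ 3 ∧ 2 ^ k * t = 36 * w ^ 3 ∨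
        4 ^ k * N = 9 * z ^ 3 ∧ 2 ^ k * t = 4 * w ^ 3) := by
  have htN : t * N ≠ 0 := by rw [h]; positivity
  have split (x : ℤ) (hx : x ≠ 0) : ∃ (i : ℕ) (x' : ℤ), ¬ 2 ∣ x' ∧ x = 2 ^ i * x' := by
    obtain ⟨x', h1, h2⟩ := (Int.finiteMultiplicity_iff.2
      ⟨by norm_num, hx⟩ : FiniteMultiplicity 2 x).exists_eq_pow_mul_and_not_dvd
    exact ⟨_, x', h2, h1⟩
  obtain ⟨i, t, ht, rfl⟩ := split t (left_ne_zero_of_mul htN)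
  obtain ⟨j, N, hN, rfl⟩ := split N (right_ne_zero_of_mul htN)
  obtain ⟨l, f, hf2, rfl⟩ := split f hf
  obtain ⟨hij, h⟩ := two_pow_mul_odd_injective (a := i + j) (b := 5 + 3 * l) (x := t * N)
    (y := 9 * f ^ 3) (fun h2 => (Int.prime_two.dvd_or_dvd h2).elim ht hN)
    (fun h2 => (Int.prime_two.dvd_or_dvd h2).elim (by norm_num)
      fun h2 => hf2 (Int.prime_two.dvd_of_dvd_pow h2))
    (by rw [pow_add, pow_add, pow_mul']; linear_combination h)
  have hcop' : IsCoprime t N := by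
    refine isCoprime_of_prime_dvd (fun h0 => ht (by simp [h0.1])) fun r hr h1 h2 => ?_
    have h3 := hcop r hr (dvd_mul_of_dvd_right h1 _) (dvd_mul_of_dvd_right h2 _)
    exact ht (((Int.prime_two.dvd_prime_iff_associated hr).2
      ((hr.dvd_prime_iff_associated Int.prime_two).1 h3).symm).trans h1)
  have h4 : (4 : ℤ) = 2 ^ 2 := by norm_num
  have finish (z w : ℤ) (hzw : 36 * (w * z) ^ 3 = 2 ^ j * (2 ^ i * t) * (4 ^ j * (2 ^ j * N))) :
      2 * 2 ^ j * (2 ^ l * f) = w * z := by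
    refine (Odd.strictMono_pow (n := 3) (by decide)).injective ?_
    have e1 : (2 : ℤ) ^ j * (2 ^ i * t) * (4 ^ j * (2 ^ j * N)) =
        2 ^ (i + j) * (2 ^ j) ^ 3 * (t * N) := by
      rw [h4, ← pow_mul, pow_mul', pow_add]; ring
    rw [e1, hij, h, pow_add, pow_mul'] at hzw
    linarith
  have e2 (x : ℤ) : (4 : ℤ) ^ j * (2 ^ j * x) = (2 ^ j) ^ 3 * x := by
    rw [h4, ← pow_mul, pow_mul']; ring
  have e3 (x : ℤ) : (2 : ℤ) ^ j * (2 ^ i * x) = 4 * (2 * 2 ^ l) ^ 3 * x := by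
    rw [← mul_assoc, ← pow_add, add_comm j, hij, pow_add, pow_mul']; ring
  by_cases h3 : 3 ∣ t
  · have h3N : IsCoprime 3 N := hcop'.of_isCoprime_of_dvd_left h3
    obtain ⟨t, rfl⟩ : 9 ∣ t := (h3N.mul_left h3N).dvd_of_dvd_mul_right ⟨f ^ 3, by linarith⟩
    obtain ⟨⟨w, rfl⟩, z, rfl⟩ := Int.eq_pow_of_mul_eq_pow_odd (k := 3) (c := f)
      (hcop'.of_mul_left_right) (by decide) (by linarith)
    have h1 : (4 : ℤ) ^ j * (2 ^ j * z ^ 3) = (2 ^ j * z) ^ 3 := by rw [e2]; ring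
    have h2 : (2 : ℤ) ^ j * (2 ^ i * (9 * w ^ 3)) = 36 * (2 * 2 ^ l * w) ^ 3 := by rw [e3]; ring
    exact ⟨j, 2 ^ j * z, 2 * 2 ^ l * w, finish _ _ (by rw [h1, h2]; ring), .inl ⟨h1, h2⟩⟩
  · have h3t : IsCoprime 3 t := (Int.prime_three.coprime_iff_not_dvd).2 h3
    obtain ⟨N, rfl⟩ : 9 ∣ N := (h3t.mul_left h3t).dvd_of_dvd_mul_left ⟨f ^ 3, by linarith⟩
    obtain ⟨⟨w, rfl⟩, z, rfl⟩ := Int.eq_pow_of_mul_eq_pow_odd (k := 3) (c := f)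
      (hcop'.of_mul_right_right) (by decide) (by linarith)
    have h1 : (4 : ℤ) ^ j * (2 ^ j * (9 * z ^ 3)) = 9 * (2 ^ j * z) ^ 3 := by rw [e2]; ring
    have h2 : (2 : ℤ) ^ j * (2 ^ i * w ^ 3) = 4 * (2 * 2 ^ l * w) ^ 3 := by rw [e3]; ring
    exact ⟨j, 2 ^ j * z, 2 * 2 ^ l * w, finish _ _ (by rw [h1, h2]; ring), .inr ⟨h1, h2⟩⟩

theorem exists_norm_of_norm_eq_nine_mul {p s n : ℤ} (h : p ^ 2 + 2 * s ^ 2 = 9 * n)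
    (hp : ¬ 3 ∣ p) : ∃ x y : ℤ, p = -x - 4 * y ∧ (s = 2 * x - y ∨ s = -(2 * x - y)) ∧
      x ^ 2 + 2 * y ^ 2 = n := by
  have h9 : 9 ∣ (2 * p + s) * (2 * p - s) := ⟨4 * n - s ^ 2, by linear_combination 4 * h⟩
  have aux (s : ℤ) (h : p ^ 2 + 2 * s ^ 2 = 9 * n) (hs : 9 ∣ 2 * p + s) :
      ∃ x y : ℤ, p = -x - 4 * y ∧ s = 2 * x - y ∧ x ^ 2 + 2 * y ^ 2 = n := by
    obtain ⟨k, hk⟩ := hs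
    obtain rfl : s = 9 * k - 2 * p := by linarith
    exact ⟨4 * k - p, -k, by ring, by ring, by linarith⟩
  by_cases h3 : 3 ∣ 2 * p + s
  · have h3' : IsCoprime 3 (2 * p - s) :=
      (Int.prime_three.coprime_iff_not_dvd).2 (by omega)
    obtain ⟨x, y, h1, h2, h3⟩ := aux s h ((h3'.mul_left h3').dvd_of_dvd_mul_right h9)
    exact ⟨x, y, h1, .inl h2, h3⟩
  · have h3' : IsCoprime 3 (2 * p + s) := (Int.prime_three.coprime_iff_not_dvd).2 h3
    obtain ⟨x, y, h1, h2, h3⟩ := aux (-s) (by linarith)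
      ((h3'.mul_left h3').dvd_of_dvd_mul_left h9)
    exact ⟨x, y, h1, .inr (by linarith), h3⟩

theorem exists_int_eq_of_sq_eq_intCast {x : ℚ} {k : ℤ} (h : x ^ 2 = k) : ∃ n : ℤ, x = n := by
  obtain ⟨n, rfl⟩ := Rat.isSquare_intCast_iff.1 ⟨x, by rw [← h, sq]⟩
  push_cast at h
  rcases sq_eq_sq_iff_eq_or_eq_neg.1 (h.trans (sq (n : ℚ)).symm) with rfl | rfl
  · exact ⟨n, rfl⟩
  · exact ⟨-n, by push_cast; rfl⟩

/-- `(A, B, e)` are the coordinates of a rational point `(A / e², B / e³)`, in lowest terms, of the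
curve `y² = u³ + 6(3u - 8)²`. -/
structure IsReducedPoint (A B e : ℤ) : Prop where
  ne_zero : e ≠ 0
  isCoprime : IsCoprime A e
  equation : B ^ 2 = A ^ 3 + 6 * e ^ 2 * (3 * A - 8 * e ^ 2) ^ 2

theorem exists_isReducedPoint {u y : ℚ} (h : y ^ 2 = u ^ 3 + 6 * (3 * u - 8) ^ 2) :
    ∃ A B e : ℤ, IsReducedPoint A B e ∧ u * e ^ 2 = A ∧ y * e ^ 3 = B := by
  have hu : u * u.den = u.num := Rat.mul_den_eq_num u
  have hcop : IsCoprime u.num (u.den : ℤ) := by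
    simpa [Int.isCoprime_iff_gcd_eq_one, Int.gcd] using u.reduced
  obtain ⟨c, hc⟩ : ∃ c : ℤ, y * (u.den : ℚ) ^ 2 = c := by
    apply exists_int_eq_of_sq_eq_intCast (k := u.den *
      (u.num ^ 3 + 6 * u.den * (3 * u.num - 8 * u.den) ^ 2))
    push_cast
    rw [← hu]
    linear_combination (u.den : ℚ) ^ 4 * h
  have hc2 : (u.den : ℤ) * (u.num ^ 3 + 6 * u.den * (3 * u.num - 8 * u.den) ^ 2) = c ^ 2 := by
    have : (u.den : ℚ) * (u.num ^ 3 + 6 * u.den * (3 * u.num - 8 * u.den) ^ 2) = c ^ 2 := by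
      rw [← hc, ← hu]
      linear_combination -(u.den : ℚ) ^ 4 * h
    exact_mod_cast this
  obtain ⟨e, he⟩ : ∃ e : ℤ, (u.den : ℤ) = e ^ 2 := by
    obtain ⟨e, he | he⟩ := Int.sq_of_isCoprime
      (show IsCoprime (u.den : ℤ) (u.num ^ 3 + 6 * u.den * (3 * u.num - 8 * u.den) ^ 2) by
        rw [mul_right_comm, mul_comm _ (u.den : ℤ), IsCoprime.add_mul_left_right_iff]
        exact hcop.symm.pow_right) hc2
    · exact ⟨e, he⟩
    · have := u.den_pos
      exact absurd he (by have := sq_nonneg e; omega)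
  have he' : (u.den : ℚ) = e ^ 2 := by exact_mod_cast he
  rw [he'] at hu
  rw [he] at hcop
  obtain ⟨B, hB⟩ : ∃ B : ℤ, y * (e : ℚ) ^ 3 = B := by
    apply exists_int_eq_of_sq_eq_intCast
      (k := u.num ^ 3 + 6 * e ^ 2 * (3 * u.num - 8 * e ^ 2) ^ 2)
    push_cast
    rw [← hu]
    linear_combination (e : ℚ) ^ 6 * h
  refine ⟨u.num, B, e, ⟨?_, (IsCoprime.pow_right_iff two_pos).1 hcop, ?_⟩, hu, hB⟩
  · rintro rfl
    simp at he
  · have : (B : ℚ) ^ 2 = u.num ^ 3 + 6 * e ^ 2 * (3 * u.num - 8 * e ^ 2) ^ 2 := by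
      rw [← hu, ← hB]
      linear_combination (e : ℚ) ^ 6 * h
    exact_mod_cast this

namespace IsReducedPoint

variable {A B e : ℤ}

theorem not_three_dvd (h : IsReducedPoint A B e) : ¬ 3 ∣ A := by
  rintro ⟨A, rfl⟩
  have heq := h.equation
  obtain ⟨B, rfl⟩ : 3 ∣ B := Int.prime_three.dvd_of_dvd_pow (n := 2)
    ⟨9 * A ^ 3 + 2 * e ^ 2 * (3 * (3 * A) - 8 * e ^ 2) ^ 2, by linear_combination heq⟩
  have h3 : 3 ∣ e ^ 6 := by
    ring_nf at heq
    omega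
  have := h.isCoprime.isUnit_of_dvd' (dvd_mul_right 3 A) (Int.prime_three.dvd_of_dvd_pow h3)
  exact Int.prime_three.not_isUnit this

/-- The descent through the `3`-isogeny with kernel generated by `u = 0`. -/
theorem exists_cubic (h : IsReducedPoint A B e) :
    ∃ p q : ℤ, A = p ^ 2 - 6 * q ^ 2 ∧
      3 * p ^ 2 * q + 6 * q ^ 3 = e * (3 * (p ^ 2 - 6 * q ^ 2) - 8 * e ^ 2) := by
  obtain ⟨v, p, q, hv, hC, rfl⟩ := exists_eq_cube_of_sq_sub_six_mul_sq_eq_cube (x := B)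
    (y := e * (3 * A - 8 * e ^ 2)) (c := A) (by rw [h.equation]; ring) h.not_three_dvd
    fun r hr h1 h2 => by
      have hA : r ∣ A := hr.dvd_of_dvd_pow (n := 3) <| by
        rw [show A ^ 3 = B ^ 2 - 6 * (e * (3 * A - 8 * e ^ 2)) ^ 2 by rw [h.equation]; ring]
        exact dvd_sub (dvd_pow h1 two_ne_zero) (dvd_mul_of_dvd_right (dvd_pow h2 two_ne_zero) _)
      have he : ¬ r ∣ e := fun he => hr.not_isUnit (h.isCoprime.isUnit_of_dvd' hA he)
      have h8 : r ∣ 2 ^ 3 * e ^ 2 := by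
        have := dvd_sub (dvd_mul_of_dvd_right hA 3) ((hr.dvd_or_dvd h2).resolve_left he)
        rwa [show 3 * A - (3 * A - 8 * e ^ 2) = 2 ^ 3 * e ^ 2 by ring] at this
      rcases hr.dvd_or_dvd h8 with h8 | h8
      · exact hr.dvd_of_dvd_pow h8
      · exact absurd (hr.dvd_of_dvd_pow h8) he
  refine ⟨p, q, rfl, ?_⟩
  have h3 : ¬ 3 ∣ p := fun h3 => h.not_three_dvd (by
    obtain ⟨p, rfl⟩ := h3
    exact ⟨3 * p ^ 2 - 2 * q ^ 2, by ring⟩)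
  rcases hv with rfl | rfl | rfl
  · linarith
  · exact absurd (three_dvd_of_unit_twist (q := q) (e := e) (by linarith)) h3
  · refine absurd (three_dvd_of_unit_twist (p := -p) (q := q) (e := e) (by linarith)) ?_
    rwa [dvd_neg]

/-- The descent through the dual `3`-isogeny. -/
theorem exists_descent (h : IsReducedPoint A B e) :
    ∃ (a b m z : ℤ) (k : ℕ), m ≠ 0 ∧ 2 ^ k * e = 3 * (2 * b - m) * z ∧
      a ^ 2 * m = -16 * b ^ 3 + 78 * b ^ 2 * m - 48 * b * m ^ 2 + 8 * m ^ 3 := by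
  obtain ⟨p, q, rfl, hpq⟩ := h.exists_cubic
  have hp3 : ¬ 3 ∣ p := fun h3 => h.not_three_dvd (by
    obtain ⟨p, rfl⟩ := h3
    exact ⟨3 * p ^ 2 - 2 * q ^ 2, by ring⟩)
  have dvd_of_dvd_three {r n : ℤ} (hr : Prime r) (h3 : r ∣ 3) (hn : r ∣ n) : 3 ∣ n :=
    ((Int.prime_three.dvd_prime_iff_associated hr).2
      ((hr.dvd_prime_iff_associated Int.prime_three).1 h3).symm).trans hn
  have hpe {r : ℤ} (hr : Prime r) (h1 : r ∣ p) (h2 : r ∣ e) : r ∣ 2 := by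
    have h6 : r ∣ 2 * (3 * q ^ 3) := by
      rw [show 2 * (3 * q ^ 3) = e * (3 * (p ^ 2 - 6 * q ^ 2) - 8 * e ^ 2) - p * (3 * p * q) by
        rw [← hpq]; ring]
      exact dvd_sub (dvd_mul_of_dvd_left h2 _) (dvd_mul_of_dvd_left h1 _)
    rcases hr.dvd_or_dvd h6 with h6 | h6
    · exact h6
    rcases hr.dvd_or_dvd h6 with h6 | h6
    · exact absurd (dvd_of_dvd_three hr h6 h1) hp3
    · exact absurd (h.isCoprime.isUnit_of_dvd' (dvd_sub (dvd_pow h1 two_ne_zero)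
        (dvd_mul_of_dvd_right (dvd_pow (hr.dvd_of_dvd_pow h6) two_ne_zero) _)) h2) hr.not_isUnit
  obtain ⟨f, rfl⟩ : 3 ∣ e := Int.prime_three.dvd_of_dvd_pow (n := 3)
    ⟨3 * e ^ 3 + p ^ 2 * q + 2 * q ^ 3 - e * (p ^ 2 - 6 * q ^ 2), by linarith⟩
  have hf : f ≠ 0 := fun hf => h.ne_zero (by simp [hf])
  obtain ⟨t, rfl⟩ : ∃ t, q = 3 * f - t := ⟨3 * f - q, by ring⟩
  set s := 9 * f - t with hs
  have heq : t * (p ^ 2 + 2 * s ^ 2) = 288 * f ^ 3 := by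
    rw [hs]
    linarith
  have h288 {r : ℤ} (hr : Prime r) (hdvd : r ∣ 288 * f ^ 3) : r ∣ 2 ∨ r ∣ 3 ∨ r ∣ f := by
    rw [show 288 * f ^ 3 = 2 ^ 5 * (3 ^ 2 * f ^ 3) by ring] at hdvd
    rcases hr.dvd_or_dvd hdvd with h' | h'
    · exact .inl (hr.dvd_of_dvd_pow h')
    · exact .inr ((hr.dvd_or_dvd h').imp hr.dvd_of_dvd_pow hr.dvd_of_dvd_pow)
  have hps {r : ℤ} (hr : Prime r) (h1 : r ∣ p) (h2 : r ∣ s) : r ∣ 2 := by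
    have hN : r ∣ p ^ 2 + 2 * s ^ 2 :=
      dvd_add (dvd_pow h1 two_ne_zero) (dvd_mul_of_dvd_right (dvd_pow h2 two_ne_zero) _)
    rcases h288 hr (heq ▸ dvd_mul_of_dvd_right hN _) with h' | h' | h'
    · exact h'
    · exact absurd (dvd_of_dvd_three hr h' h1) hp3
    · exact hpe hr h1 (dvd_mul_of_dvd_right h' _)
  obtain ⟨k, z, w, hfwz, hcase⟩ := exists_cubes_of_mul_eq heq hf fun r hr h1 h2 => by
    have hp9 (h9 : r ∣ 9 * f) : r ∣ 2 := by
      have h3 : r ∣ s := dvd_sub h9 h1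
      refine hps hr (hr.dvd_of_dvd_pow (n := 2) ?_) h3
      exact (dvd_add_left (dvd_mul_of_dvd_right (dvd_pow h3 two_ne_zero) _)).1 h2
    rcases h288 hr (heq ▸ dvd_mul_of_dvd_left h1 _) with h' | h' | h'
    · exact h'
    · exact hp9 (dvd_mul_of_dvd_left (h'.trans (by norm_num)) _)
    · exact hp9 (dvd_mul_of_dvd_right h' _)
  have hps' {r : ℤ} (hr : Prime r) (h1 : r ∣ 2 ^ k * p) (h2 : r ∣ 2 ^ k * s) : r ∣ 2 := by
    rcases hr.dvd_or_dvd h1 with h1 | h1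
    · exact hr.dvd_of_dvd_pow h1
    rcases hr.dvd_or_dvd h2 with h2 | h2
    · exact hr.dvd_of_dvd_pow h2
    exact hps hr h1 h2
  have hnorm : (2 ^ k * p) ^ 2 + 2 * (2 ^ k * s) ^ 2 = 4 ^ k * (p ^ 2 + 2 * s ^ 2) := by
    rw [show (4 : ℤ) = 2 ^ 2 by norm_num, ← pow_mul, pow_mul']
    ring
  have hsw : 2 * (2 ^ k * s) = 9 * (w * z) - 2 * (2 ^ k * t) := by
    rw [hs, ← hfwz]
    ring
  rcases hcase with ⟨hz, hw⟩ | ⟨hz, hw⟩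
  · obtain ⟨a, b, -, hs', rfl⟩ := exists_eq_cube_of_sq_add_two_mul_sq_eq_cube
      (hnorm.trans hz) fun r hr => hps' hr
    rw [hs', hw] at hsw
    obtain ⟨b, rfl⟩ : 3 ∣ b := Int.prime_three.dvd_of_dvd_pow (n := 3)
      ⟨2 * a ^ 2 * b - b ^ 3 - 3 * w * (a ^ 2 + 2 * b ^ 2) + 24 * w ^ 3, by linarith⟩
    have hcub : a ^ 2 * (2 * b - w) = -16 * b ^ 3 + 78 * b ^ 2 * (2 * b - w) -
        48 * b * (2 * b - w) ^ 2 + 8 * (2 * b - w) ^ 3 := by linarith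
    refine ⟨a, b, 2 * b - w, a ^ 2 + 2 * (3 * b) ^ 2, k + 1, fun hm => ?_, ?_, hcub⟩
    · rw [hm] at hcub
      obtain rfl : b = 0 := by simpa using hcub
      obtain rfl : w = 0 := by simpa using hm
      simp [hf] at hfwz
    · rw [pow_succ]
      linear_combination 3 * hfwz
  · have hp3' : ¬ 3 ∣ 2 ^ k * p := fun h' => (Int.prime_three.dvd_or_dvd h').elim
      (fun h' => absurd (Int.prime_three.dvd_of_dvd_pow h') (by norm_num)) hp3
    obtain ⟨x, y, hx, hy, hxy⟩ := exists_norm_of_norm_eq_nine_mul (hnorm.trans hz) hp3'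
    obtain ⟨a, b, rfl, rfl, rfl⟩ := exists_eq_cube_of_sq_add_two_mul_sq_eq_cube hxy
      fun r hr h1 h2 => by
        refine hps' hr ?_ ?_
        · rw [hx]
          exact dvd_sub ((dvd_neg).2 h1) (dvd_mul_of_dvd_right h2 _)
        · have := dvd_sub (dvd_mul_of_dvd_right h1 2) h2
          rcases hy with hy | hy <;> rw [hy]
          · exact this
          · exact (dvd_neg).2 this
    exfalso
    have hab : 3 ∣ a ∧ 3 ∣ b := by
      rw [hw] at hsw
      rcases hy with hy | hy <;> rw [hy] at hsw
      · exact three_dvd_of_norm_nine_twist (w := w) (by linarith)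
      · exact three_dvd_of_norm_nine_twist (w := -w) (by linarith)
    obtain ⟨⟨a, rfl⟩, b, rfl⟩ := hab
    apply hp3'
    rw [hx]
    exact ⟨-9 * a ^ 3 + 54 * a * b ^ 2 - 4 * (27 * a ^ 2 * b - 18 * b ^ 3), by ring⟩

/-- A rational point is, up to sign, three times a rational point whose denominator has smaller
`3`-adic valuation. -/
theorem exists_smaller (h : IsReducedPoint A B e) :
    ∃ (A' B' e' : ℤ) (k : ℕ), IsReducedPoint A' B' e' ∧ 3 * e' ∣ 2 ^ k * e := by
  obtain ⟨a, b, m, z, k, hm, he, hab⟩ := h.exists_descent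
  have hmQ : (m : ℚ) ≠ 0 := by exact_mod_cast hm
  have habQ : (a : ℚ) ^ 2 * m = -16 * b ^ 3 + 78 * b ^ 2 * m - 48 * b * m ^ 2 + 8 * m ^ 3 := by
    exact_mod_cast hab
  obtain ⟨A', B', e', h', hA, hB⟩ := exists_isReducedPoint
    (u := (8 * m - 16 * b) / m) (y := 16 * a / m) (by
      field_simp
      linear_combination 256 * habQ)
  have hA : (8 * m - 16 * b) * e' ^ 2 = A' * m := by
    field_simp at hA
    rw [mul_comm A']
    exact_mod_cast hA
  have hB : 16 * a * e' ^ 3 = B' * m := by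
    field_simp at hB
    rw [mul_comm B']
    exact_mod_cast hB
  obtain ⟨g, rfl⟩ : e' ^ 2 ∣ m := h'.isCoprime.symm.pow_left.dvd_of_dvd_mul_left
    ⟨_, by rw [← hA, mul_comm]⟩
  have hBe : IsCoprime e' B' := by
    refine ((IsCoprime.pow_left_iff two_pos).1 (?_ : IsCoprime (B' ^ 2) e')).symm
    rw [h'.equation, show A' ^ 3 + 6 * e' ^ 2 * (3 * A' - 8 * e' ^ 2) ^ 2 =
      A' ^ 3 + e' * (6 * e' * (3 * A' - 8 * e' ^ 2) ^ 2) by ring,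
      IsCoprime.add_mul_left_left_iff]
    exact h'.isCoprime.pow_left
  have he0 : e' ^ 2 ≠ 0 := pow_ne_zero 2 h'.ne_zero
  obtain ⟨g, rfl⟩ : e' ∣ g := hBe.dvd_of_dvd_mul_left
    ⟨16 * a, mul_left_cancel₀ he0 (by linear_combination -hB)⟩
  have hb : 8 * (e' ^ 2 * (e' * g)) - 16 * b = A' * (e' * g) :=
    mul_left_cancel₀ he0 (by linear_combination hA)
  refine ⟨A', B', e', k + 3, h', -(g * A' * z), ?_⟩
  rw [pow_add]
  linear_combination 8 * he - 3 * z * hb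

theorem three_pow_dvd (n : ℕ) {A B e : ℤ} (h : IsReducedPoint A B e) : 3 ^ n ∣ e := by
  induction n generalizing A B e with
  | zero => simp
  | succ n ih =>
    obtain ⟨A', B', e', k, h', hdvd⟩ := h.exists_smaller
    have h32 : IsCoprime ((3 : ℤ) ^ (n + 1)) (2 ^ k) :=
      IsCoprime.pow ⟨1, -1, by norm_num⟩
    refine h32.dvd_of_dvd_mul_left (dvd_trans ?_ hdvd)
    rw [pow_succ']
    exact mul_dvd_mul_left 3 (ih h')

end IsReducedPoint

/-- The elliptic curve given by `Y² = -4X³ + 60X² + 15X + 2` has no affine rational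
points. -/
theorem no_rational_points_elliptic (X Y : ℚ) :
    Y ^ 2 ≠ -4 * X ^ 3 + 60 * X ^ 2 + 15 * X + 2 := by
  intro h
  obtain ⟨A, B, e, hP, -, -⟩ := exists_isReducedPoint (u := 2 - 4 * X) (y := 4 * Y)
    (by linear_combination 16 * h)
  refine hP.ne_zero (Int.eq_zero_of_abs_lt_dvd (hP.three_pow_dvd e.natAbs) ?_)
  rw [Int.abs_eq_natAbs]
  exact_mod_cast Nat.lt_pow_self (by norm_num)
end
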